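/- Let ℓ ∈ {2, 3, 5} and let k be an odd integer with either k > 2ℓ + 2, or (ℓ, k) = (2, 5). There exists N such that for every integer n > N the following holds: let q > 0 be the real number with n = 2(q^ℓ + q^{ℓ−1} + ⋯ + q + 1). If G is a graph on n vertices that contains no cycle of length 2m for any 2 ≤ m ≤ ℓ, contains no cycle of length k, and has e(G) ≥ (q+1)n/2, then q is a positive integer, G is bipartite with both parts of size n/2, every vertex of G has degree q + 1 (so e(G) = (q+1)n/2), G has no cycle of length at most 2ℓ + 1, and any two vertices of G are at distance at most ℓ + 1. -/

import Mathlib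

open SimpleGraph

/-- `G` contains a cycle of length `m` (as a subgraph). -/
def HasCycleLength {V : Type*} (G : SimpleGraph V) (m : ℕ) : Prop :=
  ∃ (v : V) (w : G.Walk v v), w.IsCycle ∧ w.length = m

/-- `G` is `𝓒_{2ℓ}`-free: it contains no cycle of length `2m` for any `2 ≤ m ≤ ℓ`. -/
def EvenCycleFree {V : Type*} (G : SimpleGraph V) (ℓ : ℕ) : Prop :=
  ∀ m, 2 ≤ m → m ≤ ℓ → ¬ HasCycleLength G (2 * m)


namespace ECF
open SimpleGraph

variable {V : Type} {G : SimpleGraph V}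

/-- There is a walk of length at most `i`. -/
def Near (G : SimpleGraph V) (i : ℕ) (x z : V) : Prop := ∃ p : G.Walk x z, p.length ≤ i

/-- `z` is at distance exactly `i` from `x`. -/
def Lev (G : SimpleGraph V) (i : ℕ) (x z : V) : Prop := Near G i x z ∧ ∀ j, j < i → ¬ Near G j x z

lemma Near.symm {i : ℕ} {x z : V} (h : Near G i x z) : Near G i z x := by
  obtain ⟨p, hp⟩ := h
  exact ⟨p.reverse, by simpa using hp⟩

lemma Near.trans {i j : ℕ} {x y z : V} (h : Near G i x y) (h' : Near G j y z) :
    Near G (i + j) x z := by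
  obtain ⟨p, hp⟩ := h
  obtain ⟨p', hp'⟩ := h'
  exact ⟨p.append p', by rw [Walk.length_append]; omega⟩

lemma Near.mono {i j : ℕ} {x y : V} (h : Near G i x y) (hij : i ≤ j) : Near G j x y := by
  obtain ⟨p, hp⟩ := h
  exact ⟨p, hp.trans hij⟩

lemma near_of_adj {x y : V} (h : G.Adj x y) : Near G 1 x y := ⟨h.toWalk, by simp⟩

lemma near_zero {x y : V} : Near G 0 x y ↔ x = y := by
  constructor
  · rintro ⟨p, hp⟩
    exact Walk.eq_of_length_eq_zero (p := p) (by omega)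
  · rintro rfl
    exact ⟨Walk.nil, by simp⟩

lemma Near.parent {i : ℕ} {x z : V} (h : Near G (i + 1) x z) :
    x = z ∨ ∃ y, Near G i x y ∧ G.Adj y z := by
  obtain ⟨p, hp⟩ := h.symm
  cases p with
  | nil => exact Or.inl rfl
  | cons h p =>
    right
    refine ⟨_, Near.symm ⟨p, ?_⟩, h.symm⟩
    simp at hp
    omega

lemma Lev.symm {i : ℕ} {x z : V} (h : Lev G i x z) : Lev G i z x :=
  ⟨h.1.symm, fun j hj hn => h.2 j hj hn.symm⟩

lemma lev_comm {i : ℕ} {x z : V} : Lev G i x z ↔ Lev G i z x := ⟨Lev.symm, Lev.symm⟩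

lemma Lev.le {i j : ℕ} {x z : V} (h : Lev G i x z) (h' : Near G j x z) : i ≤ j := by
  by_contra hc
  exact h.2 j (by omega) h'

lemma Lev.unique {i j : ℕ} {x z : V} (h : Lev G i x z) (h' : Lev G j x z) : i = j :=
  le_antisymm (h.le h'.1) (h'.le h.1)

lemma Near.lev {i : ℕ} {x z : V} (h : Near G i x z) : ∃ j, j ≤ i ∧ Lev G j x z := by
  classical
  have hex : ∃ j, Near G j x z := ⟨i, h⟩
  exact ⟨Nat.find hex, Nat.find_min' hex h, Nat.find_spec hex, fun j hj => Nat.find_min hex hj⟩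

lemma lev_zero {x y : V} : Lev G 0 x y ↔ x = y := by
  simp [Lev, near_zero]

lemma lev_one {x y : V} : Lev G 1 x y ↔ G.Adj x y := by
  constructor
  · rintro ⟨h, h'⟩
    have h0 := h' 0 (by omega)
    rw [near_zero] at h0
    rcases h.parent with h1 | ⟨y', h1, h2⟩
    · exact absurd h1 h0
    · rw [near_zero] at h1
      rwa [h1]
  · intro h
    refine ⟨near_of_adj h, fun j hj hn => ?_⟩
    have : j = 0 := by omega
    subst this
    rw [near_zero] at hn
    exact h.ne hn

lemma Lev.parent {i : ℕ} {x z : V} (h : Lev G (i + 1) x z) : ∃ y, Lev G i x y ∧ G.Adj y z := by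
  rcases h.1.parent with h1 | ⟨y, h1, h2⟩
  · exact absurd (near_zero.2 h1) (h.2 0 (by omega))
  · refine ⟨y, ⟨h1, fun j hj hn => ?_⟩, h2⟩
    exact h.2 (j + 1) (by omega) (hn.trans (near_of_adj h2))

/-- The level of a neighbour. -/
lemma Lev.adj {i : ℕ} {x y z : V} (h : Lev G i x y) (hyz : G.Adj y z) :
    Lev G (i + 1) x z ∨ Lev G i x z ∨ (∃ j, j + 1 = i ∧ Lev G j x z) := by
  obtain ⟨j, hj, hl⟩ := (h.1.trans (near_of_adj hyz)).lev
  have := h.le (hl.1.trans (near_of_adj hyz.symm))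
  rcases (show j = i + 1 ∨ j = i ∨ j + 1 = i by omega) with h1 | h1 | h1
  · left; rwa [← h1]
  · right; left; rwa [← h1]
  · right; right; exact ⟨j, h1, hl⟩

/-- Splitting a distance through an intermediate vertex. -/
lemma Lev.split {i j : ℕ} {x y z : V} (h : Lev G (i + j) x z) (h1 : Near G i x y)
    (h2 : Near G j y z) : Lev G i x y ∧ Lev G j y z := by
  refine ⟨⟨h1, fun t ht hn => ?_⟩, ⟨h2, fun t ht hn => ?_⟩⟩
  · exact h.2 (t + j) (by omega) (hn.trans h2)
  · exact h.2 (i + t) (by omega) (h1.trans hn)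

/-- Geodesics. -/
lemma Lev.geodesic : ∀ {i : ℕ} {x z : V}, Lev G i x z →
    ∃ p : G.Walk x z, p.IsPath ∧ p.length = i ∧
      ∀ y ∈ p.support, ∃ j t, j + t = i ∧ Lev G j x y ∧ Lev G t y z
  | 0, x, z, h => by
    have := lev_zero.1 h
    subst this
    refine ⟨Walk.nil, by simp, by simp, fun y hy => ?_⟩
    simp at hy
    subst hy
    exact ⟨0, 0, rfl, h, h⟩
  | i + 1, x, z, h => by
    obtain ⟨y, hy, hyz⟩ := h.parent
    obtain ⟨p, hp, hl, hs⟩ := hy.geodesic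
    have key : ∀ w ∈ p.support, ∃ j t, j + t = i + 1 ∧ Lev G j x w ∧ Lev G t w z ∧ j ≤ i := by
      intro w hw
      obtain ⟨j, t, hjt, h1, h2⟩ := hs w hw
      have h3 : Lev G (j + (t + 1)) x z := by
        have : j + (t + 1) = i + 1 := by omega
        rwa [this]
      obtain ⟨h4, h5⟩ := h3.split h1.1 (h2.1.trans (near_of_adj hyz))
      exact ⟨j, t + 1, by omega, h4, h5, by omega⟩
    refine ⟨p.concat hyz, ?_, by simp [hl], ?_⟩
    · refine hp.concat (fun hz => ?_) hyz
      obtain ⟨j, t, hjt, h1, h2, h3⟩ := key z hz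
      have := h1.unique h
      omega
    · intro w hw
      rw [Walk.support_concat] at hw
      simp at hw
      rcases hw with hw | hw
      · obtain ⟨j, t, hjt, h1, h2, h3⟩ := key w hw
        exact ⟨j, t, hjt, h1, h2⟩
      · subst hw
        exact ⟨i + 1, 0, rfl, h, lev_zero.2 rfl⟩

/-- Closing a path to a cycle. -/
lemma hasCycle_of_path {u v : V} (p : G.Walk u v) (hp : p.IsPath) (h : G.Adj v u)
    (hl : 2 ≤ p.length) : HasCycleLength G (p.length + 1) := by
  refine ⟨v, Walk.cons h p, ?_, by simp⟩
  rw [Walk.cons_isCycle_iff]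
  refine ⟨hp, fun hm => ?_⟩
  rw [Sym2.eq_swap] at hm
  have := hp.length_eq_one_of_mem_edges hm
  omega

/-- Two distinct vertices on the same level are joined by an even path through lower levels. -/
lemma meet : ∀ (j : ℕ) {x w w' : V}, Lev G j x w → Lev G j x w' → w ≠ w' →
    ∃ (s : ℕ) (p : G.Walk w w'), 1 ≤ s ∧ s ≤ j ∧ p.IsPath ∧ p.length = 2 * s ∧
      ∀ z ∈ p.support, z = w ∨ z = w' ∨ ∃ i, i < j ∧ Lev G i x z
  | 0, x, w, w', h, h', hne => by
    exact absurd ((lev_zero.1 h).symm.trans (lev_zero.1 h')) hne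
  | j + 1, x, w, w', h, h', hne => by
    obtain ⟨y, hy, hyw⟩ := h.parent
    obtain ⟨y', hy', hyw'⟩ := h'.parent
    by_cases hyy : y = y'
    · subst hyy
      refine ⟨1, Walk.cons hyw.symm (Walk.cons hyw' Walk.nil), le_rfl, by omega, ?_, by simp, ?_⟩
      · simp [Walk.cons_isPath_iff, hyw'.ne, hyw.ne.symm, hne]
      · intro z hz
        simp at hz
        rcases hz with rfl | rfl | rfl
        · exact Or.inl rfl
        · exact Or.inr (Or.inr ⟨j, by omega, hy⟩)
        · exact Or.inr (Or.inl rfl)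
    · obtain ⟨s, p, hs1, hs2, hp, hl, hsup⟩ := meet j hy hy' hyy
      have key : ∀ z ∈ p.support, ∃ i, i < j + 1 ∧ Lev G i x z := by
        intro z hz
        rcases hsup z hz with rfl | rfl | ⟨i, hi, hz⟩
        · exact ⟨j, by omega, hy⟩
        · exact ⟨j, by omega, hy'⟩
        · exact ⟨i, by omega, hz⟩
      have hw : w ∉ p.support := by
        intro hz
        obtain ⟨i, hi, hz⟩ := key w hz
        have := hz.unique h
        omega
      have hw' : w' ∉ p.support := by
        intro hz
        obtain ⟨i, hi, hz⟩ := key w' hz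
        have := hz.unique h'
        omega
      refine ⟨s + 1, Walk.cons hyw.symm (p.concat hyw'), by omega, by omega, ?_, ?_, ?_⟩
      · rw [Walk.cons_isPath_iff]
        refine ⟨hp.concat hw' hyw', ?_⟩
        rw [Walk.support_concat]
        simp [hw, hne]
      · simp [hl]; ring
      · intro z hz
        rw [Walk.support_cons, Walk.support_concat] at hz
        simp at hz
        rcases hz with rfl | hz | rfl
        · exact Or.inl rfl
        · exact Or.inr (Or.inr (key z hz))
        · exact Or.inr (Or.inl rfl)

/-- Two common neighbours of a vertex on the same level give a short even cycle. -/
lemma two_nbrs {j : ℕ} {x v w w' : V} (h : Lev G j x w) (h' : Lev G j x w')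
    (hw : G.Adj v w) (hw' : G.Adj v w') (hne : w ≠ w') (hv : ∀ i, i < j → ¬ Lev G i x v) :
    ∃ s, 2 ≤ s ∧ s ≤ j + 1 ∧ HasCycleLength G (2 * s) := by
  obtain ⟨s, p, hs1, hs2, hp, hl, hsup⟩ := meet j h h' hne
  have hvp : v ∉ p.support := by
    intro hz
    rcases hsup v hz with rfl | rfl | ⟨i, hi, hz⟩
    · exact hw.ne rfl
    · exact hw'.ne rfl
    · exact hv i hi hz
  refine ⟨s + 1, by omega, by omega, ?_⟩
  have := hasCycle_of_path (Walk.cons hw p) (by rw [Walk.cons_isPath_iff]; exact ⟨hp, hvp⟩)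
    hw'.symm (by simp; omega)
  have h2 : 2 * (s + 1) = (Walk.cons hw p).length + 1 := by simp [hl]; ring
  rwa [h2]

variable {ℓ : ℕ}

lemma two_nbrs' (hG : EvenCycleFree G ℓ) {j : ℕ} {x v w w' : V} (h : Lev G j x w)
    (h' : Lev G j x w') (hj : j + 1 ≤ ℓ)
    (hw : G.Adj v w) (hw' : G.Adj v w') (hv : ∀ i, i < j → ¬ Lev G i x v) : w = w' := by
  by_contra hne
  obtain ⟨s, h1, h2, h3⟩ := two_nbrs h h' hw hw' hne hv
  exact hG s h1 (by omega) h3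

/-- Unique parents. -/
lemma parent_unique (hG : EvenCycleFree G ℓ) {j : ℕ} {x v w w' : V} (hv : Lev G (j + 1) x v)
    (h : Lev G j x w) (h' : Lev G j x w') (hj : j + 1 ≤ ℓ)
    (hw : G.Adj v w) (hw' : G.Adj v w') : w = w' :=
  two_nbrs' hG h h' hj hw hw' (fun i hi hl => by have := hl.unique hv; omega)

/-- At most one sibling. -/
lemma sibling_unique (hG : EvenCycleFree G ℓ) {j : ℕ} {x v w w' : V} (hv : Lev G j x v)
    (h : Lev G j x w) (h' : Lev G j x w') (hj : j + 1 ≤ ℓ)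
    (hw : G.Adj v w) (hw' : G.Adj v w') : w = w' :=
  two_nbrs' hG h h' hj hw hw' (fun i hi hl => by have := hl.unique hv; omega)

/-- Adjacent vertices on a level give a short odd cycle. -/
lemma odd_cycle_of_sibling {j : ℕ} {x w w' : V} (h : Lev G j x w) (h' : Lev G j x w')
    (hw : G.Adj w w') : ∃ s, 1 ≤ s ∧ s ≤ j ∧ HasCycleLength G (2 * s + 1) := by
  obtain ⟨s, p, hs1, hs2, hp, hl, hsup⟩ := meet j h h' hw.ne
  refine ⟨s, hs1, hs2, ?_⟩
  have := hasCycle_of_path p hp hw.symm (by omega)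
  rwa [hl] at this

end ECF

namespace ECF
open SimpleGraph
open scoped Classical

section counting
variable {V : Type} [Fintype V] {G : SimpleGraph V} {ℓ : ℕ}

/-- Neighbours as a finset. -/
noncomputable def nbr (G : SimpleGraph V) (x : V) : Finset V := Finset.univ.filter (fun y => G.Adj x y)

/-- Real-valued degree. -/
noncomputable def dg (G : SimpleGraph V) (x : V) : ℝ := ((nbr G x).card : ℝ)

/-- The vertices on level `i`. -/
noncomputable def levs (G : SimpleGraph V) (i : ℕ) (x : V) : Finset V :=
  Finset.univ.filter (fun y => Lev G i x y)

/-- The adjacency operator. -/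
noncomputable def op (G : SimpleGraph V) (f : V → ℝ) : V → ℝ := fun x => ∑ y ∈ nbr G x, f y

/-- Neighbours of `z` that are not on level `i+1`. -/
noncomputable def back (G : SimpleGraph V) (i : ℕ) (x z : V) : Finset V :=
  (nbr G z).filter (fun y => ¬ Lev G (i + 1) x y)

@[simp] lemma mem_nbr {x y : V} : y ∈ nbr G x ↔ G.Adj x y := by simp [nbr]

@[simp] lemma mem_levs {i : ℕ} {x y : V} : y ∈ levs G i x ↔ Lev G i x y := by simp [levs]

lemma dg_eq_op (x : V) : dg G x = op G (fun _ => 1) x := by simp [dg, op]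

lemma dg_nonneg (x : V) : 0 ≤ dg G x := by simp [dg]

lemma sum_dg : ∑ x, dg G x = 2 * (G.edgeSet.ncard : ℝ) := by
  have h := G.sum_degrees_eq_twice_card_edges
  have h2 : G.edgeSet.ncard = G.edgeFinset.card := by
    rw [← SimpleGraph.coe_edgeFinset, Set.ncard_coe_finset]
  rw [h2]
  have h3 : ∀ x, dg G x = (G.degree x : ℝ) := by
    intro x
    rw [dg, ← SimpleGraph.card_neighborFinset_eq_degree]
    congr 2
    ext y
    simp
  simp_rw [h3]
  exact_mod_cast h

lemma op_add (f g : V → ℝ) : op G (fun x => f x + g x) = fun x => op G f x + op G g x := by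
  funext x; simp [op, Finset.sum_add_distrib]

lemma op_smul (c : ℝ) (f : V → ℝ) : op G (fun x => c * f x) = fun x => c * op G f x := by
  funext x; simp [op, Finset.mul_sum]

lemma op_mono {f g : V → ℝ} (h : ∀ x, f x ≤ g x) (x : V) : op G f x ≤ op G g x :=
  Finset.sum_le_sum (fun y _ => h y)

lemma op_eq_ite (f : V → ℝ) (x : V) : op G f x = ∑ y, if G.Adj x y then f y else 0 := by
  simp [op, nbr, Finset.sum_filter]

lemma op_adj (f g : V → ℝ) : ∑ x, op G f x * g x = ∑ x, f x * op G g x := by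
  simp_rw [op_eq_ite, Finset.sum_mul, Finset.mul_sum]
  rw [Finset.sum_comm]
  refine Finset.sum_congr rfl (fun x _ => Finset.sum_congr rfl (fun y _ => ?_))
  by_cases h : G.Adj x y
  · simp [h, h.symm]
  · have h' : ¬ G.Adj y x := fun h2 => h h2.symm
    simp [h, h']

lemma sum_op (f : V → ℝ) : ∑ x, op G f x = ∑ x, f x * dg G x := by
  have := op_adj (G := G) f (fun _ => 1)
  simp at this
  rw [this]
  simp_rw [dg_eq_op]

lemma op_abs_le {f : V → ℝ} {B D : ℝ} (hB : ∀ x, |f x| ≤ B) (hD : ∀ x, dg G x ≤ D) (hB0 : 0 ≤ B)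
    (x : V) : |op G f x| ≤ D * B := by
  calc |op G f x| ≤ ∑ y ∈ nbr G x, |f y| := Finset.abs_sum_le_sum_abs _ _
    _ ≤ ∑ y ∈ nbr G x, B := Finset.sum_le_sum (fun y _ => hB y)
    _ = dg G x * B := by simp [dg]
    _ ≤ D * B := mul_le_mul_of_nonneg_right (hD x) hB0

lemma card_back (hG : EvenCycleFree G ℓ) {i : ℕ} (hi : i + 1 ≤ ℓ) {x z : V} (hz : Lev G i x z) :
    (back G i x z).card ≤ 2 := by
  have h1 : back G i x z ⊆ (nbr G z).filter (fun y => Lev G i x y) ∪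
      (nbr G z).filter (fun y => ∃ j, j + 1 = i ∧ Lev G j x y) := by
    intro y hy
    simp only [back, Finset.mem_filter, mem_nbr, Finset.mem_union] at hy ⊢
    rcases hz.adj hy.1 with h | h | h
    · exact absurd h hy.2
    · exact Or.inl ⟨hy.1, h⟩
    · exact Or.inr ⟨hy.1, h⟩
  have h2 : ((nbr G z).filter (fun y => Lev G i x y)).card ≤ 1 := by
    rw [Finset.card_le_one]
    intro a ha b hb
    simp only [Finset.mem_filter, mem_nbr] at ha hb
    exact sibling_unique hG hz ha.2 hb.2 hi ha.1 hb.1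
  have h3 : ((nbr G z).filter (fun y => ∃ j, j + 1 = i ∧ Lev G j x y)).card ≤ 1 := by
    rw [Finset.card_le_one]
    intro a ha b hb
    simp only [Finset.mem_filter, mem_nbr] at ha hb
    obtain ⟨ha1, j, hj, ha⟩ := ha
    obtain ⟨hb1, j', hj', hb⟩ := hb
    obtain rfl : j = j' := by omega
    subst hj
    exact parent_unique hG hz ha hb (by omega) ha1 hb1
  calc _ ≤ _ := Finset.card_le_card h1
    _ ≤ _ := Finset.card_union_le _ _
    _ ≤ 2 := by omega

lemma sum_next (hG : EvenCycleFree G ℓ) {i : ℕ} (hi : i + 1 ≤ ℓ) (x : V) (f : V → ℝ) :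
    ∑ z ∈ levs G i x, op G f z = ∑ y ∈ levs G (i + 1) x, f y +
      ∑ z ∈ levs G i x, ∑ y ∈ back G i x z, f y := by
  have h1 : ∀ z, op G f z = ∑ y ∈ (nbr G z).filter (fun y => Lev G (i + 1) x y), f y +
      ∑ y ∈ back G i x z, f y := by
    intro z
    rw [op, back, Finset.sum_filter_add_sum_filter_not]
  simp_rw [h1]
  rw [Finset.sum_add_distrib]
  congr 1
  rw [Finset.sum_comm' (t' := levs G (i + 1) x)
    (s' := fun y => (nbr G y).filter (fun z => Lev G i x z))]
  · refine Finset.sum_congr rfl (fun y hy => ?_)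
    rw [mem_levs] at hy
    obtain ⟨z, hz, hzy⟩ := hy.parent
    have : (nbr G y).filter (fun z => Lev G i x z) = {z} := by
      ext w
      simp only [Finset.mem_filter, mem_nbr, Finset.mem_singleton]
      constructor
      · rintro ⟨h2, h3⟩
        exact parent_unique hG hy h3 hz hi h2 hzy.symm
      · rintro rfl
        exact ⟨hzy.symm, hz⟩
    rw [this]
    simp
  · intro z y
    simp only [Finset.mem_filter, mem_nbr, mem_levs]
    constructor
    · rintro ⟨h1, h2, h3⟩; exact ⟨⟨h2.symm, h1⟩, h3⟩
    · rintro ⟨⟨h2, h1⟩, h3⟩; exact ⟨h1, h2.symm, h3⟩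

lemma levs_zero (x : V) : levs G 0 x = {x} := by
  ext y; simp [lev_zero, eq_comm]

lemma levs_one (x : V) : levs G 1 x = nbr G x := by
  ext y; simp [lev_one]

lemma back_sum_le (hG : EvenCycleFree G ℓ) {i : ℕ} (hi : i + 1 ≤ ℓ) (x : V) {f : V → ℝ} {B : ℝ}
    (hB : ∀ x, |f x| ≤ B) (hB0 : 0 ≤ B) :
    |∑ z ∈ levs G i x, ∑ y ∈ back G i x z, f y| ≤ (levs G i x).card * (2 * B) := by
  calc _ ≤ ∑ z ∈ levs G i x, |∑ y ∈ back G i x z, f y| := Finset.abs_sum_le_sum_abs _ _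
    _ ≤ ∑ z ∈ levs G i x, 2 * B := by
      refine Finset.sum_le_sum (fun z hz => ?_)
      rw [mem_levs] at hz
      calc _ ≤ ∑ y ∈ back G i x z, |f y| := Finset.abs_sum_le_sum_abs _ _
        _ ≤ ∑ y ∈ back G i x z, B := Finset.sum_le_sum (fun y _ => hB y)
        _ = (back G i x z).card * B := by simp
        _ ≤ 2 * B := by
          refine mul_le_mul_of_nonneg_right ?_ hB0
          exact_mod_cast card_back hG hi hz
    _ = _ := by simp

lemma levs_succ_ge (hG : EvenCycleFree G ℓ) {i : ℕ} (hi : i + 1 ≤ ℓ) (x : V) {d : ℝ}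
    (hd : ∀ x, d ≤ dg G x) :
    ((levs G i x).card : ℝ) * (d - 2) ≤ (levs G (i + 1) x).card := by
  have h1 := sum_next hG hi x (fun _ => 1)
  have h2 := back_sum_le hG hi x (f := fun _ => 1) (B := 1) (by simp) (by simp)
  have h3 : ((levs G i x).card : ℝ) * d ≤ ∑ z ∈ levs G i x, op G (fun _ => 1) z := by
    rw [← nsmul_eq_mul, ← Finset.sum_const]
    exact Finset.sum_le_sum (fun z _ => by rw [← dg_eq_op]; exact hd z)
  rw [abs_le] at h2
  have h4 : ∑ y ∈ levs G (i + 1) x, (1 : ℝ) = (levs G (i + 1) x).card := by simp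
  rw [h4] at h1
  linarith [h2.2]

lemma levs_succ_le {i : ℕ} (x : V) {D : ℝ} (hD : ∀ x, dg G x ≤ D) :
    ((levs G (i + 1) x).card : ℝ) ≤ (levs G i x).card * D := by
  have h1 : levs G (i + 1) x ⊆ (levs G i x).biUnion (fun z => nbr G z) := by
    intro y hy
    rw [mem_levs] at hy
    obtain ⟨z, hz, hzy⟩ := hy.parent
    simp only [Finset.mem_biUnion, mem_levs, mem_nbr]
    exact ⟨z, hz, hzy⟩
  have h2 := (Finset.card_le_card h1).trans Finset.card_biUnion_le
  calc ((levs G (i + 1) x).card : ℝ) ≤ ((∑ z ∈ levs G i x, (nbr G z).card : ℕ) : ℝ) := by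
        exact_mod_cast h2
    _ = ∑ z ∈ levs G i x, dg G z := by push_cast; rfl
    _ ≤ ∑ z ∈ levs G i x, D := Finset.sum_le_sum (fun z _ => hD z)
    _ = _ := by simp

lemma levs_le {i : ℕ} (x : V) {D : ℝ} (hD : ∀ x, dg G x ≤ D) :
    ((levs G i x).card : ℝ) ≤ D ^ i := by
  have hD0 : 0 ≤ D := (dg_nonneg x).trans (hD x)
  induction i with
  | zero => simp [levs_zero]
  | succ i ih =>
    calc _ ≤ _ := levs_succ_le x hD
      _ ≤ D ^ i * D := mul_le_mul_of_nonneg_right ih hD0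
      _ = _ := by ring

lemma levs_ge (hG : EvenCycleFree G ℓ) {i : ℕ} (hi : i + 1 ≤ ℓ) (x : V) {d : ℝ}
    (hd : ∀ x, d ≤ dg G x) (hd2 : 2 ≤ d) :
    dg G x * (d - 2) ^ i ≤ (levs G (i + 1) x).card := by
  induction i with
  | zero => simp [levs_one, dg]
  | succ i ih =>
    calc _ = (dg G x * (d - 2) ^ i) * (d - 2) := by ring
      _ ≤ (levs G (i + 1) x).card * (d - 2) :=
        mul_le_mul_of_nonneg_right (ih (by omega)) (by linarith)
      _ ≤ _ := levs_succ_ge hG hi x hd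

/-- Walk counts versus level sums. -/
lemma op_iter (hG : EvenCycleFree G ℓ) {D : ℝ} (hD : ∀ x, dg G x ≤ D) {i : ℕ} (hi : i ≤ ℓ) (x : V) :
    ∀ {f : V → ℝ} {B : ℝ}, (∀ x, |f x| ≤ B) → 0 ≤ B →
    |(op G)^[i] f x - ∑ z ∈ levs G i x, f z| ≤ 2 * i * D ^ (i - 1) * B := by
  have hD0 : 0 ≤ D := (dg_nonneg x).trans (hD x)
  induction i with
  | zero => intro f B _ _; simp [levs_zero]
  | succ i ih =>
    intro f B hB hB0
    have h1 := ih (by omega) (f := op G f) (B := D * B) (op_abs_le hB hD hB0) (by positivity)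
    have h2 := sum_next hG hi x f
    have h3 := back_sum_le hG hi x hB hB0
    have h4 := levs_le (i := i) x hD
    have h5 : ((levs G i x).card : ℝ) * (2 * B) ≤ D ^ i * (2 * B) :=
      mul_le_mul_of_nonneg_right h4 (by positivity)
    rw [Function.iterate_succ_apply]
    have h6 : 2 * (i : ℝ) * D ^ (i - 1) * (D * B) = 2 * i * D ^ i * B := by
      cases i with
      | zero => simp
      | succ i => simp; ring
    rw [h6] at h1
    simp only [Nat.add_sub_cancel]
    push_cast
    rw [abs_le] at h1 h3 ⊢
    constructor <;> nlinarith

end counting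
end ECF

namespace ECF
open SimpleGraph
open scoped Classical

lemma log_aux1 {s : ℝ} (hs : 1 ≤ s) : 2 * (s - 1) ≤ (s + 1) * Real.log s := by
  have hm : MonotoneOn (fun s : ℝ => (s + 1) * Real.log s - 2 * (s - 1)) (Set.Ici 1) := by
    have hd : ∀ x : ℝ, 1 ≤ x → HasDerivAt (fun s : ℝ => (s + 1) * Real.log s - 2 * (s - 1))
        (1 * Real.log x + (x + 1) * x⁻¹ - 2 * 1) x := by
      intro x hx
      exact (((hasDerivAt_id x).add_const 1).mul (Real.hasDerivAt_log (by linarith))).sub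
        (((hasDerivAt_id x).sub_const 1).const_mul 2)
    refine monotoneOn_of_deriv_nonneg (convex_Ici 1) ?_ ?_ ?_
    · intro x hx
      exact (hd x hx).continuousAt.continuousWithinAt
    · intro x hx
      rw [interior_Ici] at hx
      exact (hd x (le_of_lt hx)).differentiableAt.differentiableWithinAt
    · intro x hx
      rw [interior_Ici] at hx
      have hx' : (1 : ℝ) < x := hx
      rw [(hd x (le_of_lt hx)).deriv]
      have := Real.one_sub_inv_le_log_of_pos (show 0 < x by linarith)
      have h2 : (x + 1) * x⁻¹ = 1 + x⁻¹ := by field_simp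
      rw [h2]
      linarith
  have := hm (Set.mem_Ici.2 le_rfl) (Set.mem_Ici.2 hs) hs
  simp at this
  linarith

lemma log_aux2 {s : ℝ} (hs : 1 ≤ s) : 2 * Real.log s ≤ s - s⁻¹ := by
  have hm : MonotoneOn (fun s : ℝ => s - s⁻¹ - 2 * Real.log s) (Set.Ici 1) := by
    have hd : ∀ x : ℝ, 1 ≤ x → HasDerivAt (fun s : ℝ => s - s⁻¹ - 2 * Real.log s)
        (1 - (-(x ^ 2)⁻¹) - 2 * x⁻¹) x := by
      intro x hx
      exact ((hasDerivAt_id x).sub (hasDerivAt_inv (by linarith))).sub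
        ((Real.hasDerivAt_log (by linarith)).const_mul 2)
    refine monotoneOn_of_deriv_nonneg (convex_Ici 1) ?_ ?_ ?_
    · intro x hx
      exact (hd x hx).continuousAt.continuousWithinAt
    · intro x hx
      rw [interior_Ici] at hx
      exact (hd x (le_of_lt hx)).differentiableAt.differentiableWithinAt
    · intro x hx
      rw [interior_Ici] at hx
      rw [(hd x (le_of_lt hx)).deriv]
      rw [← inv_pow]
      nlinarith [sq_nonneg (1 - x⁻¹)]
  have := hm (Set.mem_Ici.2 le_rfl) (Set.mem_Ici.2 hs) hs
  simp at this
  linarith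

lemma tangent {t q : ℝ} (ht : 1 ≤ t) (hq : 1 ≤ q) :
    (q + 1) / q * (t - q) ≤ (t + 1) * (Real.log t - Real.log q) := by
  have hq0 : 0 < q := by linarith
  have ht0 : 0 < t := by linarith
  rw [← Real.log_div ht0.ne' hq0.ne']
  rcases le_total q t with h | h
  · have hs : 1 ≤ t / q := by rwa [one_le_div hq0]
    have h1 := log_aux1 hs
    have h0 := Real.one_sub_inv_le_log_of_pos (show 0 < t / q by positivity)
    set s := t / q with hsd
    have ht' : t = q * s := by rw [hsd]; field_simp
    have h3 : (q + 1) / q * (t - q) = (q + 1) * (s - 1) := by rw [ht']; field_simp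
    rw [h3, ht']
    have h4 : s - 1 ≤ s * Real.log s := by
      have : s * (1 - s⁻¹) = s - 1 := by field_simp
      nlinarith
    nlinarith
  · have hs : 1 ≤ q / t := by rwa [one_le_div ht0]
    have h1 := log_aux2 hs
    have h0 := Real.log_le_sub_one_of_pos (show 0 < q / t by positivity)
    have h2 : Real.log (t / q) = - Real.log (q / t) := by
      rw [← Real.log_inv, inv_div]
    rw [h2]
    set x := q / t with hxd
    have hx0 : 0 < x := by linarith
    have hq' : q = t * x := by rw [hxd]; field_simp
    have h3 : (q + 1) / q * (t - q) = - ((t * x + 1) * (1 - x⁻¹)) := by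
      rw [hq']; field_simp; ring
    rw [h3]
    -- (t+1) log x ≤ (t x+1)(1 - 1/x)
    have h5 : (t * x + 1) * (1 - x⁻¹) = t * (x - 1) + (1 - x⁻¹) := by field_simp
    rw [h5]
    nlinarith [mul_nonneg (sub_nonneg.2 ht) (sub_nonneg.2 h0)]

lemma avg_log {α : Type} (s : Finset α) (g : α → ℝ) (hg : ∀ x ∈ s, 0 < g x) (hs : s.Nonempty) :
    ∑ x ∈ s, Real.log (g x) ≤ s.card * Real.log ((∑ x ∈ s, g x) / s.card) := by
  have hc : (0 : ℝ) < s.card := by exact_mod_cast hs.card_pos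
  have hS : 0 < ∑ x ∈ s, g x := Finset.sum_pos hg hs
  set a := (∑ x ∈ s, g x) / s.card with ha
  have ha0 : 0 < a := by positivity
  have h1 : ∀ x ∈ s, Real.log (g x) ≤ Real.log a + (g x / a - 1) := by
    intro x hx
    have := Real.log_le_sub_one_of_pos (div_pos (hg x hx) ha0)
    rw [Real.log_div (hg x hx).ne' ha0.ne'] at this
    linarith
  calc _ ≤ ∑ x ∈ s, (Real.log a + (g x / a - 1)) := Finset.sum_le_sum h1
    _ = s.card * Real.log a + ((∑ x ∈ s, g x) / a - s.card) := by
      rw [Finset.sum_add_distrib, Finset.sum_sub_distrib, Finset.sum_div]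
      simp
    _ = s.card * Real.log a := by
      have : (∑ x ∈ s, g x) / a = s.card := by rw [ha]; field_simp
      rw [this]; ring

section nb
variable {V : Type} [Fintype V] {G : SimpleGraph V}

/-- Non-backtracking walk counts. -/
noncomputable def nb (G : SimpleGraph V) : ℕ → V → V → ℝ
  | 0, _, _ => 1
  | r + 1, u, v => ∑ w ∈ (nbr G v).erase u, nb G r v w

/-- Sum over darts. -/
noncomputable def dsum (G : SimpleGraph V) (F : V → V → ℝ) : ℝ := ∑ u, ∑ v ∈ nbr G u, F u v

lemma dsum_swap (F : V → V → ℝ) : dsum G F = dsum G (fun u v => F v u) := by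
  unfold dsum
  rw [Finset.sum_comm' (t' := Finset.univ) (s' := fun y => nbr G y)]
  intro x y
  simp [G.adj_comm]

lemma dsum_mono {F F' : V → V → ℝ} (h : ∀ u v, G.Adj u v → F u v ≤ F' u v) :
    dsum G F ≤ dsum G F' :=
  Finset.sum_le_sum (fun u _ => Finset.sum_le_sum (fun v hv => h u v (mem_nbr.1 hv)))

lemma dsum_add (F F' : V → V → ℝ) : dsum G (fun u v => F u v + F' u v) = dsum G F + dsum G F' := by
  simp [dsum, Finset.sum_add_distrib]

lemma dsum_const (c : ℝ) : dsum G (fun _ _ => c) = c * ∑ x, dg G x := by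
  simp [dsum, dg, Finset.mul_sum, mul_comm]

lemma dsum_left (f : V → ℝ) : dsum G (fun u _ => f u) = ∑ u, dg G u * f u := by
  simp [dsum, dg]

lemma dsum_eq_sigma (F : V → V → ℝ) :
    dsum G F = ∑ p ∈ Finset.univ.sigma (fun u => nbr G u), F p.1 p.2 := by
  rw [dsum, Finset.sum_sigma]

lemma card_erase_nbr {u v : V} (h : G.Adj u v) : (((nbr G v).erase u).card : ℝ) = dg G v - 1 := by
  rw [dg, Finset.card_erase_of_mem (mem_nbr.2 h.symm), Nat.cast_sub, Nat.cast_one]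
  exact Finset.card_pos.2 ⟨u, mem_nbr.2 h.symm⟩

lemma nb_nonneg (r : ℕ) (u v : V) : 0 ≤ nb G r u v := by
  induction r generalizing u v with
  | zero => simp [nb]
  | succ r ih => exact Finset.sum_nonneg (fun w _ => ih v w)

lemma erase_nonempty (hd : ∀ x, 2 ≤ dg G x) {u v : V} (h : G.Adj u v) :
    ((nbr G v).erase u).Nonempty := by
  rw [← Finset.card_pos]
  have h1 := card_erase_nbr h
  have h2 := hd v
  have : (0 : ℝ) < ((nbr G v).erase u).card := by linarith
  exact_mod_cast this

lemma nb_pos (hd : ∀ x, 2 ≤ dg G x) (r : ℕ) {u v : V} (h : G.Adj u v) : 0 < nb G r u v := by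
  induction r generalizing u v with
  | zero => simp [nb]
  | succ r ih =>
    refine Finset.sum_pos (fun w hw => ih ?_) (erase_nonempty hd h)
    exact mem_nbr.1 (Finset.mem_of_mem_erase hw)

lemma nb_le_op (r : ℕ) (u v : V) : nb G r u v ≤ (op G)^[r] (fun _ => 1) v := by
  induction r generalizing u v with
  | zero => simp [nb]
  | succ r ih =>
    rw [Function.iterate_succ_apply']
    calc nb G (r + 1) u v ≤ ∑ w ∈ nbr G v, nb G r v w :=
          Finset.sum_le_sum_of_subset_of_nonneg (Finset.erase_subset _ _)
            (fun w _ _ => nb_nonneg _ _ _)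
      _ ≤ _ := Finset.sum_le_sum (fun w _ => ih v w)

lemma log_step (hd : ∀ x, 2 ≤ dg G x) (r : ℕ) :
    (∑ v, dg G v * Real.log (dg G v - 1)) + dsum G (fun u v => Real.log (nb G r u v)) ≤
      dsum G (fun u v => Real.log (nb G (r + 1) u v)) := by
  have h1 : ∀ u v, G.Adj u v → Real.log (dg G v - 1) +
      (∑ w ∈ (nbr G v).erase u, Real.log (nb G r v w)) / (dg G v - 1) ≤
      Real.log (nb G (r + 1) u v) := by
    intro u v h
    have hne := erase_nonempty hd h
    have h2 := avg_log ((nbr G v).erase u) (fun w => nb G r v w)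
      (fun w hw => nb_pos hd r (mem_nbr.1 (Finset.mem_of_mem_erase hw))) hne
    rw [card_erase_nbr h] at h2
    have h3 : 0 < dg G v - 1 := by linarith [hd v]
    have h4 : 0 < nb G (r + 1) u v := nb_pos hd (r + 1) h
    change _ ≤ (dg G v - 1) * Real.log (nb G (r + 1) u v / (dg G v - 1)) at h2
    rw [Real.log_div h4.ne' h3.ne'] at h2
    rw [← sub_nonneg] at h2 ⊢
    have : 0 ≤ ((dg G v - 1) * (Real.log (nb G (r + 1) u v) - Real.log (dg G v - 1)) -
        ∑ w ∈ (nbr G v).erase u, Real.log (nb G r v w)) / (dg G v - 1) := by positivity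
    rw [sub_div, mul_div_cancel_left₀ _ h3.ne'] at this
    linarith
  refine le_trans (le_of_eq ?_) (dsum_mono h1)
  rw [dsum_add]
  congr 1
  · rw [dsum_swap, dsum_left]
  · conv_rhs => rw [dsum_swap]
    unfold dsum
    refine Finset.sum_congr rfl (fun v _ => ?_)
    beta_reduce
    have h3 : 0 < dg G v - 1 := by linarith [hd v]
    rw [← Finset.sum_div, eq_div_iff h3.ne']
    have h4 : ∀ u ∈ nbr G v, ∑ w ∈ (nbr G v).erase u, Real.log (nb G r v w) =
        ∑ w ∈ nbr G v, Real.log (nb G r v w) - Real.log (nb G r v u) := by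
      intro u hu
      rw [← Finset.sum_erase_add _ _ hu]
      ring
    rw [Finset.sum_congr rfl h4, Finset.sum_sub_distrib, Finset.sum_const, nsmul_eq_mul]
    rw [← dg]
    ring

/-- Hoory-type inequality for non-backtracking walks. -/
lemma nb_sum (hd : ∀ x, 2 ≤ dg G x) {q : ℝ} (hq : 1 ≤ q)
    (hs : (q + 1) * Fintype.card V ≤ ∑ x, dg G x) (r : ℕ) :
    q ^ r * ∑ x, dg G x ≤ dsum G (nb G r) := by
  have hq0 : 0 < q := by linarith
  rcases isEmpty_or_nonempty V with hV | hV
  · simp [dsum]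
  have hE : 0 < ∑ x, dg G x := Finset.sum_pos (fun x _ => by linarith [hd x]) Finset.univ_nonempty
  have hL : Real.log q * (∑ x, dg G x) ≤ ∑ v, dg G v * Real.log (dg G v - 1) := by
    have h1 : ∀ v, (q + 1) / q * (dg G v - 1 - q) ≤
        dg G v * Real.log (dg G v - 1) - Real.log q * dg G v := by
      intro v
      have := tangent (t := dg G v - 1) (by linarith [hd v]) hq
      simp only [sub_add_cancel] at this
      linarith
    have h2 := Finset.sum_le_sum (fun v (_ : v ∈ Finset.univ) => h1 v)
    rw [Finset.sum_sub_distrib, ← Finset.mul_sum, ← Finset.mul_sum] at h2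
    have h3 : 0 ≤ ∑ i, (dg G i - 1 - q) := by
      rw [Finset.sum_sub_distrib, Finset.sum_sub_distrib]
      simp
      linarith
    have : 0 ≤ (q + 1) / q * ∑ i, (dg G i - 1 - q) := by positivity
    linarith
  have hr : r * (Real.log q * ∑ x, dg G x) ≤ dsum G (fun u v => Real.log (nb G r u v)) := by
    induction r with
    | zero => simp [nb, dsum_const]
    | succ r ih =>
      have := log_step hd r
      push_cast
      linarith
  set D := Finset.univ.sigma (fun u => nbr G u) with hDd
  have hcard : (D.card : ℝ) = ∑ x, dg G x := by
    rw [hDd, Finset.card_sigma]; push_cast; rfl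
  have hDne : D.Nonempty := by
    rw [← Finset.card_pos]
    have : (0 : ℝ) < D.card := by rw [hcard]; exact hE
    exact_mod_cast this
  have hpos : ∀ p ∈ D, 0 < nb G r p.1 p.2 := by
    intro p hp
    simp [hDd] at hp
    exact nb_pos hd r hp
  have hJ := avg_log D (fun p => nb G r p.1 p.2) hpos hDne
  rw [← dsum_eq_sigma (fun u v => nb G r u v), ← dsum_eq_sigma (fun u v => Real.log (nb G r u v)), hcard] at hJ
  have hN : 0 < dsum G (fun u v => nb G r u v) := by
    rw [dsum_eq_sigma]; exact Finset.sum_pos hpos hDne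
  have h5 : r * Real.log q ≤ Real.log (dsum G (fun u v => nb G r u v) / ∑ x, dg G x) := by
    by_contra hc
    push Not at hc
    nlinarith
  rw [← Real.log_pow, Real.log_le_log_iff (by positivity) (by positivity), le_div_iff₀ hE] at h5
  exact h5

lemma walk_sum (hd : ∀ x, 2 ≤ dg G x) {q : ℝ} (hq : 1 ≤ q)
    (hs : (q + 1) * Fintype.card V ≤ ∑ x, dg G x) (r : ℕ) :
    q ^ r * ∑ x, dg G x ≤ ∑ x, (op G)^[r + 1] (fun _ => 1) x := by
  refine (nb_sum hd hq hs r).trans ?_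
  simp_rw [Function.iterate_succ_apply']
  exact Finset.sum_le_sum (fun u _ => Finset.sum_le_sum (fun v _ => nb_le_op r u v))

end nb
end ECF

namespace ECF
open SimpleGraph
open scoped Classical

section final
set_option linter.unusedSectionVars false
variable {V : Type} [Fintype V] {G : SimpleGraph V} {ℓ : ℕ}

/-- Vertices at distance `r` from `v` and `r+1` from `u`. -/
noncomputable def RR (G : SimpleGraph V) (r : ℕ) (u v : V) : Finset V :=
  Finset.univ.filter (fun x => Lev G r v x ∧ Lev G (r + 1) u x)

lemma mem_RR {r : ℕ} {u v x : V} : x ∈ RR G r u v ↔ Lev G r v x ∧ Lev G (r + 1) u x := by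
  simp [RR]

lemma free_of_girth (hg : ∀ m, m ≤ 2 * ℓ + 1 → ¬ HasCycleLength G m) : EvenCycleFree G ℓ :=
  fun m _ h2 => hg (2 * m) (by omega)

lemma no_sib (hg : ∀ m, m ≤ 2 * ℓ + 1 → ¬ HasCycleLength G m) {j : ℕ} (hj : j ≤ ℓ) {x w w' : V}
    (h : Lev G j x w) (h' : Lev G j x w') (hw : G.Adj w w') : False := by
  obtain ⟨s, h1, h2, h3⟩ := odd_cycle_of_sibling h h' hw
  exact hg _ (by omega) h3

lemma nb_le_RR (hg : ∀ m, m ≤ 2 * ℓ + 1 → ¬ HasCycleLength G m) {r : ℕ} (hr : r ≤ ℓ) :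
    ∀ {u v : V}, G.Adj u v → nb G r u v ≤ (RR G r u v).card := by
  have hG := free_of_girth hg
  induction r with
  | zero =>
    intro u v h
    have : v ∈ RR G 0 u v := by
      rw [mem_RR]; exact ⟨lev_zero.2 rfl, lev_one.2 h⟩
    simp only [nb]
    exact_mod_cast Finset.card_pos.2 ⟨v, this⟩
  | succ r ih =>
    intro u v h
    have hsub : ((nbr G v).erase u).biUnion (fun w => RR G r v w) ⊆ RR G (r + 1) u v := by
      intro x hx
      simp only [Finset.mem_biUnion, Finset.mem_erase, mem_nbr, mem_RR] at hx ⊢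
      obtain ⟨w, ⟨hwu, hvw⟩, h1, h2⟩ := hx
      refine ⟨h2, ?_⟩
      rcases h2.symm.adj h.symm with h3 | h3 | ⟨j, hj, h3⟩
      · exact h3.symm
      · exact (no_sib hg hr h2.symm h3 h.symm).elim
      · obtain rfl : j = r := by omega
        exact absurd (parent_unique hG h2.symm h1.symm h3 hr hvw h.symm) hwu
    have hdis : ∀ w ∈ (nbr G v).erase u, ∀ w' ∈ (nbr G v).erase u, w ≠ w' →
        Disjoint (RR G r v w) (RR G r v w') := by
      intro w hw w' hw' hne
      rw [Finset.disjoint_left]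
      intro x hx hx'
      rw [mem_RR] at hx hx'
      simp only [Finset.mem_erase, mem_nbr] at hw hw'
      exact hne (parent_unique hG hx.2.symm hx.1.symm hx'.1.symm hr hw.2 hw'.2)
    calc nb G (r + 1) u v ≤ ∑ w ∈ (nbr G v).erase u, ((RR G r v w).card : ℝ) :=
          Finset.sum_le_sum (fun w hw => ih (by omega) (mem_nbr.1 (Finset.mem_of_mem_erase hw)))
      _ = ((((nbr G v).erase u).biUnion (fun w => RR G r v w)).card : ℝ) := by
          rw [Finset.card_biUnion hdis]; push_cast; rfl
      _ ≤ _ := by exact_mod_cast Finset.card_le_card hsub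

/-- Union of the `RR`. -/
noncomputable def RU (G : SimpleGraph V) (ℓ : ℕ) (u v : V) : Finset V :=
  (Finset.range (ℓ + 1)).biUnion (fun i => RR G i u v)

lemma card_RU (u v : V) : (RU G ℓ u v).card = ∑ i ∈ Finset.range (ℓ + 1), (RR G i u v).card := by
  refine Finset.card_biUnion (fun i _ j _ hne => ?_)
  change Disjoint (RR G i u v) (RR G j u v)
  rw [Finset.disjoint_left]
  intro x hx hx'
  rw [mem_RR] at hx hx'
  exact hne (hx.1.unique hx'.1)

lemma RU_disj (u v : V) : Disjoint (RU G ℓ u v) (RU G ℓ v u) := by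
  rw [Finset.disjoint_left]
  intro x hx hx'
  simp only [RU, Finset.mem_biUnion, mem_RR] at hx hx'
  obtain ⟨i, _, h1, h2⟩ := hx
  obtain ⟨j, _, h3, h4⟩ := hx'
  have := h1.unique h4
  have := h2.unique h3
  omega

/-- The count of non-backtracking walks from both ends of a dart. -/
noncomputable def nbs (G : SimpleGraph V) (ℓ : ℕ) (u v : V) : ℝ :=
  ∑ i ∈ Finset.range (ℓ + 1), (nb G i u v + nb G i v u)

lemma nbs_le_RU (hg : ∀ m, m ≤ 2 * ℓ + 1 → ¬ HasCycleLength G m) {u v : V} (h : G.Adj u v) :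
    nbs G ℓ u v ≤ ((RU G ℓ u v ∪ RU G ℓ v u).card : ℝ) := by
  rw [Finset.card_union_of_disjoint (RU_disj u v), card_RU, card_RU]
  push_cast
  rw [nbs, ← Finset.sum_add_distrib]
  refine Finset.sum_le_sum (fun i hi => ?_)
  rw [Finset.mem_range] at hi
  exact add_le_add (nb_le_RR hg (by omega) h) (nb_le_RR hg (by omega) h.symm)

lemma dsum_nbs : dsum G (nbs G ℓ) = 2 * ∑ i ∈ Finset.range (ℓ + 1), dsum G (nb G i) := by
  have h1 : dsum G (nbs G ℓ) = ∑ i ∈ Finset.range (ℓ + 1), dsum G (fun u v => nb G i u v + nb G i v u) := by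
    simp only [dsum, nbs]
    rw [Finset.sum_comm]
    refine Finset.sum_congr rfl (fun u _ => ?_)
    rw [Finset.sum_comm]
  rw [h1, Finset.mul_sum]
  refine Finset.sum_congr rfl (fun i _ => ?_)
  rw [dsum_add, ← dsum_swap]
  ring

lemma dsum_nbs_ge (hd : ∀ x, 2 ≤ dg G x) {q : ℝ} (hq : 1 ≤ q)
    (hs : (q + 1) * Fintype.card V ≤ ∑ x, dg G x) :
    (2 * ∑ i ∈ Finset.range (ℓ + 1), q ^ i) * ∑ x, dg G x ≤ dsum G (nbs G ℓ) := by
  rw [dsum_nbs, mul_assoc, Finset.sum_mul]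
  gcongr with i hi
  exact nb_sum hd hq hs i

theorem final_lemma [Nonempty V] (hℓ : 1 ≤ ℓ) (hg : ∀ m, m ≤ 2 * ℓ + 1 → ¬ HasCycleLength G m)
    (hd : ∀ x, 2 ≤ dg G x) {q : ℝ} (hq : 1 ≤ q)
    (hs : (q + 1) * Fintype.card V ≤ ∑ x, dg G x)
    (hm : (Fintype.card V : ℝ) ≤ 2 * ∑ i ∈ Finset.range (ℓ + 1), q ^ i) :
    (Fintype.card V : ℝ) = 2 * ∑ i ∈ Finset.range (ℓ + 1), q ^ i ∧
    (∀ x, dg G x = q + 1) ∧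
    (∃ A : Finset V, (∀ u v, G.Adj u v → (u ∈ A ↔ v ∉ A)) ∧ 2 * A.card = Fintype.card V ∧
      2 * Aᶜ.card = Fintype.card V) ∧
    (∀ u v, Near G (ℓ + 1) u v) := by
  have hE : 0 < ∑ x, dg G x := Finset.sum_pos (fun x _ => by linarith [hd x]) Finset.univ_nonempty
  set m : ℝ := ((Fintype.card V : ℕ) : ℝ) with hmd
  have hle : ∀ u v, G.Adj u v → nbs G ℓ u v ≤ m := by
    intro u v h
    refine (nbs_le_RU hg h).trans ?_
    rw [hmd]
    exact_mod_cast Finset.card_le_univ _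
  have h1 := dsum_nbs_ge (ℓ := ℓ) hd hq hs
  have h2 := dsum_mono hle
  rw [dsum_const] at h2
  have hmn : m = 2 * ∑ i ∈ Finset.range (ℓ + 1), q ^ i := by
    refine le_antisymm hm ?_
    by_contra hc
    push Not at hc
    nlinarith
  have heq : dsum G (nbs G ℓ) = m * ∑ x, dg G x := by
    refine le_antisymm h2 ?_
    rw [hmn]; exact h1
  -- degree regularity
  have hn1 : dsum G (nb G 1) = q * ∑ x, dg G x := by
    rw [dsum_nbs, hmn] at heq
    have h3 : ∑ i ∈ Finset.range (ℓ + 1), dsum G (nb G i) =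
        ∑ i ∈ Finset.range (ℓ + 1), q ^ i * ∑ x, dg G x := by
      rw [← Finset.sum_mul]; linarith
    have h4 := (Finset.sum_eq_sum_iff_of_le (fun i _ => nb_sum hd hq hs i)).1 h3.symm 1
      (by simp; omega)
    rw [← h4, pow_one]
  have hreg : ∀ x, dg G x = q + 1 := by
    have h3 : dsum G (nb G 1) = ∑ x, dg G x * (dg G x - 1) := by
      have : dsum G (nb G 1) = dsum G (fun u v => dg G v - 1) := by
        unfold dsum
        refine Finset.sum_congr rfl (fun u _ => Finset.sum_congr rfl (fun v hv => ?_))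
        simp only [nb]
        rw [← card_erase_nbr (mem_nbr.1 hv)]
        simp
      rw [this, dsum_swap, dsum_left]
    have h4 : ∑ x, (dg G x - (q + 1)) ^ 2 ≤ 0 := by
      have h5 : ∀ x, (dg G x - (q + 1)) ^ 2 = dg G x * (dg G x - 1) - (2 * q + 1) * dg G x + (q + 1) ^ 2 := by
        intro x; ring
      simp_rw [h5]
      rw [Finset.sum_add_distrib, Finset.sum_sub_distrib, ← h3, hn1, ← Finset.mul_sum]
      simp only [Finset.sum_const, Finset.card_univ, nsmul_eq_mul, ← hmd]
      nlinarith
    have h6 := (Finset.sum_eq_zero_iff_of_nonneg (fun x (_ : x ∈ Finset.univ) =>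
      sq_nonneg (dg G x - (q + 1)))).1 (le_antisymm h4 (Finset.sum_nonneg (fun x _ => sq_nonneg _)))
    intro x
    have := h6 x (Finset.mem_univ x)
    have := pow_eq_zero_iff (two_ne_zero) |>.1 this
    linarith
  -- coverage
  have hcov0 : ∀ u v, G.Adj u v → nbs G ℓ u v = m := by
    have h3 : dsum G (nbs G ℓ) = dsum G (fun _ _ => m) := by rw [heq, dsum_const]
    rw [dsum_eq_sigma, dsum_eq_sigma] at h3
    have h4 := (Finset.sum_eq_sum_iff_of_le (fun p hp => by
      simp at hp
      exact hle p.1 p.2 hp)).1 h3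
    intro u v h
    exact h4 ⟨u, v⟩ (by simpa using h)
  have hcov : ∀ u v, G.Adj u v → ∀ x, x ∈ RU G ℓ u v ∨ x ∈ RU G ℓ v u := by
    intro u v h x
    have h3 := nbs_le_RU hg h
    rw [hcov0 u v h, hmd] at h3
    have h4 : (RU G ℓ u v ∪ RU G ℓ v u) = Finset.univ := by
      apply Finset.eq_univ_of_card
      refine le_antisymm (Finset.card_le_univ _) ?_
      exact_mod_cast h3
    have := Finset.mem_univ x
    rw [← h4, Finset.mem_union] at this
    exact this
  have hcov' : ∀ u v, G.Adj u v → ∀ x, ∃ i, i ≤ ℓ ∧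
      ((Lev G i v x ∧ Lev G (i + 1) u x) ∨ (Lev G i u x ∧ Lev G (i + 1) v x)) := by
    intro u v h x
    rcases hcov u v h x with h3 | h3
    · simp only [RU, Finset.mem_biUnion, mem_RR, Finset.mem_range] at h3
      obtain ⟨i, hi, h4⟩ := h3
      exact ⟨i, by omega, Or.inl h4⟩
    · simp only [RU, Finset.mem_biUnion, mem_RR, Finset.mem_range] at h3
      obtain ⟨i, hi, h4⟩ := h3
      exact ⟨i, by omega, Or.inr h4⟩
  have hnb : ∀ u, ∃ v, G.Adj u v := by
    intro u
    have h3 : (0 : ℝ) < (nbr G u).card := by have := hd u; rw [dg] at this; linarith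
    have h4 : 0 < (nbr G u).card := by exact_mod_cast h3
    obtain ⟨v, hv⟩ := Finset.card_pos.1 h4
    exact ⟨v, mem_nbr.1 hv⟩
  have hlev : ∀ u x, ∃ i, i ≤ ℓ + 1 ∧ Lev G i u x := by
    intro u x
    obtain ⟨v, hv⟩ := hnb u
    obtain ⟨i, hi, h | h⟩ := hcov' u v hv x
    · exact ⟨i + 1, by omega, h.2⟩
    · exact ⟨i, by omega, h.1⟩
  refine ⟨hmn, hreg, ?_, ?_⟩
  · obtain ⟨u⟩ := (inferInstance : Nonempty V)
    obtain ⟨v, huv⟩ := hnb u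
    have hsib : ∀ i x y, Lev G i u x → Lev G i u y → G.Adj x y → False := by
      intro i x y hx hy hxy
      by_cases hi : i ≤ ℓ
      · exact no_sib hg hi hx hy hxy
      · have key : ∀ z, Lev G i u z → Lev G ℓ v z := by
          intro z hz
          obtain ⟨j, hj, h | h⟩ := hcov' u v huv z
          · have := h.2.unique hz
            obtain rfl : j = ℓ := by omega
            exact h.1
          · have := h.1.unique hz
            omega
        exact no_sib hg le_rfl (key x hx) (key y hy) hxy
    refine ⟨Finset.univ.filter (fun x => ∃ i, Even i ∧ Lev G i u x), ?_⟩
    set A := Finset.univ.filter (fun x => ∃ i, Even i ∧ Lev G i u x) with hA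
    have hAadj : ∀ a b, G.Adj a b → (a ∈ A ↔ b ∉ A) := by
      intro a b hab
      simp only [hA, Finset.mem_filter, Finset.mem_univ, true_and]
      obtain ⟨i, hi, hia⟩ := hlev u a
      have e1 : (∃ j, Even j ∧ Lev G j u a) ↔ Even i :=
        ⟨fun ⟨j, h1, h2⟩ => by rwa [← h2.unique hia], fun h => ⟨i, h, hia⟩⟩
      have e2 : ∀ j, Lev G j u b → ((∃ j, Even j ∧ Lev G j u b) ↔ Even j) := fun j hj =>
        ⟨fun ⟨j', h1, h2⟩ => by rwa [← h2.unique hj], fun h => ⟨j, h, hj⟩⟩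
      rw [e1]
      rcases hia.adj hab with h | h | ⟨j, hj, h⟩
      · rw [e2 _ h, Nat.even_add_one, not_not]
      · exact (hsib i a b hia h hab).elim
      · rw [e2 _ h, ← hj, Nat.even_add_one]
    have hcard : A.card = Aᶜ.card := by
      have h3 := op_adj (G := G) (fun x => if x ∈ A then 1 else 0) (fun x => if x ∈ A then 0 else 1)
      have h4 : ∀ x, op G (fun x => if x ∈ A then 1 else 0) x * (if x ∈ A then 0 else 1) =
          if x ∈ A then 0 else (q + 1) := by
        intro x
        by_cases hx : x ∈ A
        · simp [hx]
        · simp only [hx, if_false, mul_one]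
          rw [← hreg x, dg_eq_op]
          refine Finset.sum_congr rfl (fun y hy => ?_)
          have : y ∈ A := (hAadj y x (mem_nbr.1 hy).symm).2 hx
          simp [this]
      have h5 : ∀ x, (if x ∈ A then 1 else 0) * op G (fun x => if x ∈ A then 0 else 1) x =
          if x ∈ A then (q + 1) else 0 := by
        intro x
        by_cases hx : x ∈ A
        · simp only [hx, if_true, one_mul]
          rw [← hreg x, dg_eq_op]
          refine Finset.sum_congr rfl (fun y hy => ?_)
          have : y ∉ A := (hAadj x y (mem_nbr.1 hy)).1 hx
          simp [this]
        · simp [hx]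
      simp_rw [h4, h5] at h3
      have h6 : ∑ x, (if x ∈ A then (q + 1) else 0) = A.card * (q + 1) := by
        rw [Finset.sum_ite_mem, Finset.univ_inter, Finset.sum_const, nsmul_eq_mul]
      have h7 : ∑ x, (if x ∈ A then 0 else (q + 1)) = Aᶜ.card * (q + 1) := by
        have : ∀ x, (if x ∈ A then 0 else (q + 1)) = (if x ∈ Aᶜ then (q + 1) else 0) := by
          intro x; by_cases hx : x ∈ A <;> simp [hx]
        simp_rw [this]
        rw [Finset.sum_ite_mem, Finset.univ_inter, Finset.sum_const, nsmul_eq_mul]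
      rw [h6, h7] at h3
      have h8 := mul_right_cancel₀ (show q + 1 ≠ 0 by linarith) h3
      exact_mod_cast h8.symm
    have hcc := Finset.card_add_card_compl A
    exact ⟨hAadj, by omega, by omega⟩
  · intro u x
    obtain ⟨i, hi, h⟩ := hlev u x
    exact h.1.mono hi

end final
end ECF

namespace ECF
open SimpleGraph
open scoped Classical

section setup
variable {V : Type} [Fintype V] {G : SimpleGraph V} {ℓ : ℕ} {q : ℝ}

/-- The standing assumptions. -/
structure Hyp (G : SimpleGraph V) (ℓ : ℕ) (q : ℝ) : Prop where
  free : EvenCycleFree G ℓ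
  hq : 16 ≤ q
  hd : ∀ x, q / 4 ≤ dg G x
  hs : (q + 1) * Fintype.card V ≤ ∑ x, dg G x
  hm : (Fintype.card V : ℝ) ≤ 2 * ∑ i ∈ Finset.range (ℓ + 1), q ^ i

lemma geom_le {q : ℝ} (hq : 2 ≤ q) (i : ℕ) : ∑ j ∈ Finset.range (i + 1), q ^ j ≤ 2 * q ^ i := by
  induction i with
  | zero => simp
  | succ i ih =>
    rw [Finset.sum_range_succ, pow_succ]
    have : 0 < q ^ i := by positivity
    nlinarith

lemma Hyp.card_le (h : Hyp G ℓ q) (hℓ : 1 ≤ ℓ) :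
    (Fintype.card V : ℝ) ≤ 2 * q ^ ℓ + 4 * q ^ (ℓ - 1) := by
  obtain ⟨j, rfl⟩ : ∃ j, ℓ = j + 1 := ⟨ℓ - 1, by omega⟩
  have h1 := h.hm
  rw [Finset.sum_range_succ] at h1
  have := geom_le (q := q) (by linarith [h.hq]) j
  simp only [Nat.add_sub_cancel]
  linarith

lemma Hyp.card_le' (h : Hyp G ℓ q) (hℓ : 1 ≤ ℓ) : (Fintype.card V : ℝ) ≤ 3 * q ^ ℓ := by
  have h1 := h.card_le hℓ
  obtain ⟨j, rfl⟩ : ∃ j, ℓ = j + 1 := ⟨ℓ - 1, by omega⟩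
  simp only [Nat.add_sub_cancel] at h1
  have hq := h.hq
  have : 0 < q ^ j := by positivity
  rw [pow_succ] at h1 ⊢
  nlinarith

lemma Hyp.levs_ge (h : Hyp G ℓ q) {i : ℕ} (hi : i ≤ ℓ) (x : V) :
    (q / 8) ^ i ≤ (levs G i x).card := by
  have hq := h.hq
  cases i with
  | zero => simp [levs_zero]
  | succ i =>
    have h1 := ECF.levs_ge h.free hi x h.hd (by linarith)
    refine le_trans ?_ h1
    rw [pow_succ, mul_comm]
    have h2 := h.hd x
    gcongr <;> linarith

lemma Hyp.max_deg (h : Hyp G ℓ q) (hℓ : 1 ≤ ℓ) (x : V) : dg G x ≤ (3 * 8 ^ (ℓ - 1)) * q := by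
  have hq := h.hq
  have hc := h.card_le' hℓ
  obtain ⟨j, rfl⟩ : ∃ j, ℓ = j + 1 := ⟨ℓ - 1, by omega⟩
  have h1 := ECF.levs_ge h.free le_rfl x h.hd (by linarith)
  have h2 : ((levs G (j + 1) x).card : ℝ) ≤ Fintype.card V := by
    exact_mod_cast Finset.card_le_univ _
  have h3 : dg G x * (q / 8) ^ j ≤ dg G x * (q / 4 - 2) ^ j := by
    have := dg_nonneg (G := G) x
    gcongr
    linarith
  have h4 : dg G x * (q / 8) ^ j ≤ 3 * q ^ (j + 1) := by linarith
  simp only [Nat.add_sub_cancel]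
  rw [div_pow, ← mul_div_assoc, div_le_iff₀ (by positivity), pow_succ] at h4
  have h5 : 0 < q ^ j := by positivity
  have h6 : dg G x * q ^ j ≤ (3 * 8 ^ j * q) * q ^ j := by linarith
  exact le_of_mul_le_mul_right h6 h5

lemma Hyp.two_le (h : Hyp G ℓ q) (x : V) : 2 ≤ dg G x := by
  have := h.hd x
  have := h.hq
  linarith

end setup

section two
set_option linter.unusedSectionVars false
variable {V : Type} [Fintype V] {G : SimpleGraph V} {q : ℝ}

lemma c4_free (hG : EvenCycleFree G 2) {a b c d : V} (h1 : G.Adj a c) (h2 : G.Adj c b)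
    (h3 : G.Adj b d) (h4 : G.Adj d a) (hab : a ≠ b) (hcd : c ≠ d) : False := by
  have := hasCycle_of_path (Walk.cons h1 (Walk.cons h2 (Walk.cons h3 Walk.nil)))
    (by
      have := h1.ne; have := h2.ne; have := h3.ne; have := h4.ne
      simp [Walk.cons_isPath_iff]
      grind) h4 (by simp)
  exact hG 2 le_rfl le_rfl (by simpa using this)

lemma c5_free (hG : ¬ HasCycleLength G 5) {a b c d e : V} (h1 : G.Adj a b) (h2 : G.Adj b c)
    (h3 : G.Adj c d) (h4 : G.Adj d e) (h5 : G.Adj e a)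
    (hac : a ≠ c) (hbd : b ≠ d) (hce : c ≠ e) (hda : d ≠ a) (heb : e ≠ b) : False := by
  have := hasCycle_of_path (Walk.cons h1 (Walk.cons h2 (Walk.cons h3 (Walk.cons h4 Walk.nil))))
    (by
      have := h1.ne; have := h2.ne; have := h3.ne; have := h4.ne; have := h5.ne
      simp [Walk.cons_isPath_iff]
      grind) h5 (by simp)
  exact hG (by simpa using this)

/-- Second neighbours through a set of first neighbours. -/
noncomputable def PP (G : SimpleGraph V) (S : Finset V) (v : V) : Finset V :=
  S.biUnion (fun w => (nbr G w).erase v)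

lemma mem_PP {S : Finset V} {v x : V} : x ∈ PP G S v ↔ ∃ w ∈ S, x ≠ v ∧ G.Adj w x := by
  simp [PP]

lemma card_PP (hG : EvenCycleFree G 2) {S : Finset V} {v : V} (hS : ∀ w ∈ S, G.Adj v w) :
    ((PP G S v).card : ℝ) = ∑ w ∈ S, (dg G w - 1) := by
  have hdis : ∀ w ∈ S, ∀ w' ∈ S, w ≠ w' → Disjoint ((nbr G w).erase v) ((nbr G w').erase v) := by
    intro w hw w' hw' hne
    rw [Finset.disjoint_left]
    intro x hx hx'
    simp only [Finset.mem_erase, mem_nbr] at hx hx'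
    exact c4_free hG (hS w hw) hx.2 hx'.2.symm (hS w' hw').symm hx.1.symm hne
  rw [PP, Finset.card_biUnion hdis]
  push_cast
  exact Finset.sum_congr rfl (fun w hw => card_erase_nbr (hS w hw))

lemma nb_one {u v : V} (h : G.Adj u v) : nb G 1 u v = dg G v - 1 := by
  rw [← card_erase_nbr h]; simp [nb]

lemma nb_two (u v : V) : nb G 2 u v = ∑ w ∈ (nbr G v).erase u, (dg G w - 1) := by
  simp only [nb]
  refine Finset.sum_congr rfl (fun w hw => ?_)
  have := nb_one (G := G) (mem_nbr.1 (Finset.mem_of_mem_erase hw))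
  simpa [nb] using this

lemma nbs_two {u v : V} (h : G.Adj u v) :
    nbs G 2 u v = dg G u + dg G v + nb G 2 u v + nb G 2 v u := by
  rw [nbs, Finset.sum_range_succ, Finset.sum_range_succ, Finset.sum_range_one, nb_one h,
    nb_one h.symm]
  simp only [nb]
  ring

/-- Triangle darts. -/
def Tri (G : SimpleGraph V) (u v : V) : Prop := ∃ w, G.Adj u w ∧ G.Adj v w

/-- Triangle neighbours. -/
noncomputable def TT (G : SimpleGraph V) (v : V) : Finset V := (nbr G v).filter (fun y => Tri G v y)

lemma side_card (hG : EvenCycleFree G 2) {u v : V} (h : G.Adj u v) :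
    1 + (dg G v - 1) + nb G 2 u v - (TT G v).card ≤
      ((insert v ((nbr G v).erase u ∪ PP G ((nbr G v).erase u) v)).card : ℝ) := by
  have h1 : v ∉ (nbr G v).erase u ∪ PP G ((nbr G v).erase u) v := by
    simp [mem_PP]
  rw [Finset.card_insert_of_notMem h1]
  have h2 := Finset.card_union_add_card_inter ((nbr G v).erase u) (PP G ((nbr G v).erase u) v)
  have h3 : (nbr G v).erase u ∩ PP G ((nbr G v).erase u) v ⊆ TT G v := by
    intro x hx
    simp only [Finset.mem_inter, Finset.mem_erase, mem_nbr, mem_PP, TT, Finset.mem_filter] at hx ⊢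
    obtain ⟨⟨h3, h4⟩, w, ⟨h5, h6⟩, h7, h8⟩ := hx
    exact ⟨h4, w, h6, h8.symm⟩
  have h4 := Finset.card_le_card h3
  have h5 := card_PP hG (S := (nbr G v).erase u) (v := v)
    (fun w hw => mem_nbr.1 (Finset.mem_of_mem_erase hw))
  rw [← nb_two] at h5
  rw [← card_erase_nbr h, ← h5]
  have h2' : ((((nbr G v).erase u ∪ PP G ((nbr G v).erase u) v).card +
    ((nbr G v).erase u ∩ PP G ((nbr G v).erase u) v).card : ℕ) : ℝ) = _ := congrArg _ h2
  have h4' : (((nbr G v).erase u ∩ PP G ((nbr G v).erase u) v).card : ℝ) ≤ (TT G v).card := by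
    exact_mod_cast h4
  push_cast at h2' ⊢
  linarith

lemma nontri_bound (hG : EvenCycleFree G 2) (h5 : ¬ HasCycleLength G 5) {u v : V} (h : G.Adj u v)
    (ht : ¬ Tri G u v) : nbs G 2 u v - (TT G u).card - (TT G v).card ≤ Fintype.card V := by
  have h1 := side_card hG h
  have h2 := side_card hG h.symm
  have hdis : Disjoint (insert v ((nbr G v).erase u ∪ PP G ((nbr G v).erase u) v))
      (insert u ((nbr G u).erase v ∪ PP G ((nbr G u).erase v) u)) := by
    rw [Finset.disjoint_left]
    intro x hx hx'
    simp only [Finset.mem_insert, Finset.mem_union, Finset.mem_erase, mem_nbr, mem_PP] at hx hx'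
    have hT : ∀ w, G.Adj u w → G.Adj v w → False := fun w a b => ht ⟨w, a, b⟩
    rcases hx with rfl | ⟨a1, a2⟩ | ⟨w, ⟨a1, a2⟩, a3, a4⟩
    · rcases hx' with rfl | ⟨b1, b2⟩ | ⟨w', ⟨b1, b2⟩, b3, b4⟩
      · exact h.ne rfl
      · exact b1 rfl
      · exact hT w' b2 b4.symm
    · rcases hx' with rfl | ⟨b1, b2⟩ | ⟨w', ⟨b1, b2⟩, b3, b4⟩
      · exact a1 rfl
      · exact hT x b2 a2
      · exact c4_free hG h a2 b4.symm b2.symm a1.symm b1.symm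
    · rcases hx' with rfl | ⟨b1, b2⟩ | ⟨w', ⟨b1, b2⟩, b3, b4⟩
      · exact hT w a4.symm a2
      · exact c4_free hG h.symm b2 a4.symm a2.symm a3.symm a1.symm
      · refine c5_free h5 h a2 a4 b4.symm b2.symm a1.symm a3.symm ?_ b3 b1
        rintro rfl
        exact hT w b2 a2
  have h3 : (((insert v ((nbr G v).erase u ∪ PP G ((nbr G v).erase u) v)).card +
      (insert u ((nbr G u).erase v ∪ PP G ((nbr G u).erase v) u)).card : ℕ) : ℝ) ≤
      Fintype.card V := by
    rw [← Finset.card_union_of_disjoint hdis]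
    exact_mod_cast Finset.card_le_univ _
  push_cast at h3
  rw [nbs_two h]
  linarith

lemma PP_disj (hG : EvenCycleFree G 2) (h5 : ¬ HasCycleLength G 5) {u v w : V} (h : G.Adj u v)
    (hu : G.Adj u w) (hv : G.Adj v w) :
    Disjoint (PP G (((nbr G u).erase v).erase w) u) (PP G (((nbr G v).erase u).erase w) v) := by
  rw [Finset.disjoint_left]
  intro x hx hx'
  simp only [Finset.mem_erase, mem_nbr, mem_PP] at hx hx'
  obtain ⟨a, ⟨a1, a2, a3⟩, a4, a5⟩ := hx
  obtain ⟨b, ⟨b1, b2, b3⟩, b4, b5⟩ := hx'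
  have hab : a ≠ b := by
    rintro rfl
    exact c4_free hG a3 b3.symm hv hu.symm h.ne a1
  exact c5_free h5 h b3 b5 a5.symm a3.symm b2.symm b4.symm hab.symm a4 a2

lemma tri_bound (hG : EvenCycleFree G 2) (h5 : ¬ HasCycleLength G 5) {u v : V} (h : G.Adj u v)
    (ht : Tri G u v) {d D : ℝ} (hd : ∀ x, d ≤ dg G x) (hd2 : 2 ≤ d) (hD : ∀ x, dg G x ≤ D) :
    nbs G 2 u v + (d - 2) ^ 2 - 4 * D ≤ Fintype.card V := by
  obtain ⟨w, hu, hv⟩ := ht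
  have key : ∀ {a b c : V}, G.Adj a b → G.Adj a c → b ≠ c →
      ((PP G (((nbr G a).erase b).erase c) a).card : ℝ) = nb G 2 b a - (dg G c - 1) := by
    intro a b c hab hac hbc
    rw [card_PP hG (fun w hw => by simp at hw; exact hw.2.2), nb_two]
    have hmem : c ∈ (nbr G a).erase b := by simp [hbc.symm, hac]
    rw [← Finset.sum_erase_add _ _ hmem]
    ring
  have k1 := key h hu hv.ne
  have k2 := key h.symm hv hu.ne
  have k3 : (d - 2) ^ 2 ≤ ((PP G (((nbr G w).erase u).erase v) w).card : ℝ) := by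
    rw [card_PP hG (fun w hw => by simp at hw; exact hw.2.2)]
    have hmem : v ∈ (nbr G w).erase u := by simp [h.ne.symm, hv.symm]
    have hc : (((((nbr G w).erase u).erase v).card : ℕ) : ℝ) = dg G w - 2 := by
      have h1 := Finset.card_erase_add_one hmem
      have h2 := card_erase_nbr hu
      rw [← h1] at h2
      push_cast at h2
      linarith
    calc (d - 2) ^ 2 ≤ (dg G w - 2) * (d - 1) := by nlinarith [hd w]
      _ = ∑ x ∈ ((nbr G w).erase u).erase v, (d - 1) := by
        rw [Finset.sum_const, nsmul_eq_mul, hc]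
      _ ≤ _ := Finset.sum_le_sum (fun x _ => by linarith [hd x])
  have d1 := PP_disj hG h5 h hu hv
  have d2 := PP_disj hG h5 hu h hv.symm
  have d3 := PP_disj hG h5 hv h.symm hu.symm
  rw [Finset.erase_right_comm (s := nbr G u) (a := w) (b := v)] at d2
  rw [Finset.erase_right_comm (s := nbr G v) (a := w) (b := u),
    Finset.erase_right_comm (s := nbr G w) (a := v) (b := u)] at d3
  set A := PP G (((nbr G u).erase v).erase w) u
  set B := PP G (((nbr G v).erase u).erase w) v
  set C := PP G (((nbr G w).erase u).erase v) w
  have h3 : ((A.card + B.card + C.card : ℕ) : ℝ) ≤ Fintype.card V := by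
    rw [← Finset.card_union_of_disjoint d1, ← Finset.card_union_of_disjoint
      (Finset.disjoint_union_left.2 ⟨d2, d3⟩)]
    exact_mod_cast Finset.card_le_univ _
  push_cast at h3
  rw [nbs_two h]
  have := hD u
  have := hD v
  have := hD w
  linarith

set_option maxHeartbeats 1000000 in
lemma no_tri (h : Hyp G 2 q) (h5 : ¬ HasCycleLength G 5) (hq : 100000 ≤ q) :
    ∀ u v, G.Adj u v → ¬ Tri G u v := by
  have hD : ∀ x, dg G x ≤ 24 * q := by
    intro x
    have := h.max_deg (by norm_num) x
    norm_num at this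
    exact this
  set t : V → V → ℝ := fun u v => if Tri G u v then 1 else 0 with htd
  have h1 : ∀ u v, G.Adj u v → nbs G 2 u v + (t u v * (q ^ 2 / 64 - 96 * q) +
      (-(TT G u).card + -(TT G v).card)) ≤ Fintype.card V := by
    intro u v huv
    by_cases ht : Tri G u v
    · have := tri_bound h.free h5 huv ht h.hd (by linarith) hD
      simp only [htd, ht, if_true]
      have h6 : (0 : ℝ) ≤ (TT G u).card := by positivity
      have h7 : (0 : ℝ) ≤ (TT G v).card := by positivity
      nlinarith
    · have := nontri_bound h.free h5 huv ht
      simp only [htd, ht, if_false]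
      linarith
  have h2 := dsum_mono h1
  rw [dsum_const, dsum_add, dsum_add, dsum_add] at h2
  have h3 : dsum G t = ∑ u, ((TT G u).card : ℝ) := by
    simp only [dsum, htd, TT]
    refine Finset.sum_congr rfl (fun u _ => ?_)
    rw [← Finset.sum_filter]
    simp
  have h4 : dsum G (fun u _ => -((TT G u).card : ℝ)) ≥ - (24 * q * dsum G t) := by
    rw [dsum_left, h3, Finset.mul_sum, ← Finset.sum_neg_distrib]
    refine Finset.sum_le_sum (fun u _ => ?_)
    have h6 : (0 : ℝ) ≤ (TT G u).card := by positivity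
    nlinarith [hD u]
  have h4' : dsum G (fun _ v => -((TT G v).card : ℝ)) ≥ - (24 * q * dsum G t) := by
    rw [dsum_swap]; exact h4
  have h5' : dsum G (fun u v => t u v * (q ^ 2 / 64 - 96 * q)) = dsum G t * (q ^ 2 / 64 - 96 * q) := by
    simp [dsum, Finset.sum_mul]
  have h6 := dsum_nbs_ge (ℓ := 2) h.two_le (by linarith) h.hs
  have h7 := h.hm
  have hE : 0 ≤ ∑ x, dg G x := Finset.sum_nonneg (fun x _ => dg_nonneg x)
  have h8 := mul_le_mul_of_nonneg_right h7 hE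
  have ht0 : 0 ≤ dsum G t := by rw [h3]; exact Finset.sum_nonneg (fun x _ => Nat.cast_nonneg _)
  have h9 : dsum G t ≤ 0 := by
    by_contra hc
    push Not at hc
    rw [h5'] at h2
    have : dsum G t * (q ^ 2 / 64 - 144 * q) ≤ 0 := by linarith
    have : 0 < q ^ 2 / 64 - 144 * q := by nlinarith
    nlinarith
  have h10 : ∑ u, ((TT G u).card : ℝ) = 0 := by rw [← h3]; linarith
  have h11 := (Finset.sum_eq_zero_iff_of_nonneg (fun x (_ : x ∈ Finset.univ) =>
    Nat.cast_nonneg (α := ℝ) (TT G x).card)).1 h10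
  intro u v huv ht
  have h12 := h11 u (Finset.mem_univ u)
  simp at h12
  have : v ∈ TT G u := by simp [TT, huv, ht]
  rw [h12] at this
  simp at this

lemma girth_two (h : Hyp G 2 q) (h5 : ¬ HasCycleLength G 5) (hq : 100000 ≤ q) :
    ∀ m, m ≤ 2 * 2 + 1 → ¬ HasCycleLength G m := by
  intro m hm hc
  have hc' := hc
  obtain ⟨v, w, hw, hl⟩ := hc
  have h3' := hw.three_le_length
  rcases (show m = 3 ∨ m = 4 ∨ m = 5 by omega) with rfl | rfl | rfl
  · cases w with
    | nil => simp at hl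
    | cons h1 w =>
      cases w with
      | nil => simp at hl
      | cons h2 w =>
        cases w with
        | nil => simp at hl
        | cons h3 w =>
          cases w with
          | nil => exact no_tri h h5 hq _ _ h1 ⟨_, h3.symm, h2⟩
          | cons h4 w => simp at hl
  · exact h.free 2 le_rfl le_rfl hc'
  · exact h5 hc'

end two
end ECF

namespace ECF
open SimpleGraph
open scoped Classical

section sparse
set_option linter.unusedSectionVars false
variable {V : Type} [Fintype V] {G : SimpleGraph V} {ℓ k : ℕ}

lemma path_append {u v w : V} : ∀ (p : G.Walk u v) (q : G.Walk v w), p.IsPath → q.IsPath →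
    (∀ z, z ∈ p.support → z ∈ q.support → z = v) → (p.append q).IsPath
  | Walk.nil, q, _, hq, _ => by simpa using hq
  | Walk.cons h p, q, hp, hq, hz => by
    rw [Walk.cons_isPath_iff] at hp
    rw [Walk.cons_append, Walk.cons_isPath_iff]
    refine ⟨path_append p q hp.1 hq (fun z h1 h2 => hz z (by simp [h1]) h2), fun hu => ?_⟩
    rw [Walk.mem_support_append_iff] at hu
    rcases hu with hu | hu
    · exact hp.2 hu
    · have := hz _ (by simp) hu
      apply hp.2
      rw [this]
      exact Walk.end_mem_support p

/-- Degeneracy bound. -/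
lemma degen (S : Finset V)
    (h : ∀ T ⊆ S, T.Nonempty → ∃ y ∈ T, ((nbr G y) ∩ T).card ≤ k) :
    ∑ y ∈ S, ((nbr G y) ∩ S).card ≤ 2 * k * S.card := by
  induction hn : S.card generalizing S with
  | zero =>
    rw [Finset.card_eq_zero] at hn
    simp [hn]
  | succ n ih =>
    obtain ⟨y, hy, hyk⟩ := h S (Finset.Subset.refl S) (Finset.card_pos.1 (by omega))
    have h1 := ih (S.erase y) (fun T hT => h T (hT.trans (Finset.erase_subset _ _)))
      (by rw [Finset.card_erase_of_mem hy]; omega)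
    rw [← Finset.sum_erase_add _ _ hy]
    have h2 : ∑ z ∈ S.erase y, (nbr G z ∩ S).card ≤
        ∑ z ∈ S.erase y, ((nbr G z ∩ S.erase y).card + if G.Adj y z then 1 else 0) := by
      refine Finset.sum_le_sum (fun z hz => ?_)
      by_cases hyz : G.Adj y z
      · have : nbr G z ∩ S ⊆ insert y (nbr G z ∩ S.erase y) := by
          intro w hw
          simp only [Finset.mem_inter, Finset.mem_insert, Finset.mem_erase] at hw ⊢
          tauto
        simp only [hyz, if_true]
        exact (Finset.card_le_card this).trans (Finset.card_insert_le _ _)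
      · have : nbr G z ∩ S ⊆ nbr G z ∩ S.erase y := by
          intro w hw
          simp only [Finset.mem_inter, Finset.mem_erase, mem_nbr] at hw ⊢
          refine ⟨hw.1, ?_, hw.2⟩
          rintro rfl
          exact hyz hw.1.symm
        simpa [hyz] using Finset.card_le_card this
    rw [Finset.sum_add_distrib] at h2
    have h3 : ∑ z ∈ S.erase y, (if G.Adj y z then 1 else 0) ≤ (nbr G y ∩ S).card := by
      rw [← Finset.sum_filter, Finset.sum_const, smul_eq_mul, mul_one]
      apply Finset.card_le_card
      intro w hw
      simp only [Finset.mem_inter, Finset.mem_erase, Finset.mem_filter, mem_nbr] at hw ⊢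
      tauto
    have h4 : 2 * k * (n + 1) = 2 * k * n + 2 * k := by ring
    omega

lemma card_support {u v : V} (p : G.Walk u v) : p.support.toFinset.card ≤ p.length + 1 := by
  have := List.toFinset_card_le p.support
  rwa [Walk.length_support] at this

lemma greedy {T : Finset V} (hT : ∀ y ∈ T, k < ((nbr G y) ∩ T).card) {a : V} (ha : a ∈ T) :
    ∀ n, n ≤ k → ∃ (b : V) (p : G.Walk a b), p.IsPath ∧ p.length = n ∧ ∀ z ∈ p.support, z ∈ T := by
  intro n
  induction n with
  | zero => intro _; exact ⟨a, Walk.nil, by simp, by simp, by simpa using ha⟩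
  | succ n ih =>
    intro hn
    obtain ⟨b, p, hp, hl, hs⟩ := ih (by omega)
    have h1 := card_support p
    have h2 := hT b (hs b (Walk.end_mem_support p))
    obtain ⟨c, hc, hc'⟩ := Finset.exists_mem_notMem_of_card_lt_card
      (show p.support.toFinset.card < (nbr G b ∩ T).card by omega)
    simp only [Finset.mem_inter, mem_nbr] at hc
    simp only [List.mem_toFinset] at hc'
    refine ⟨c, p.concat hc.1, hp.concat hc' hc.1, by simp [hl], fun z hz => ?_⟩
    rw [Walk.support_concat] at hz
    simp at hz
    rcases hz with hz | rfl
    · exact hs z hz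
    · exact hc.2

/-- Common branches. -/
lemma branch {i j : ℕ} {x a z : V} (hj : 1 ≤ j) (h1 : Lev G j x z) (h2 : Near G i z a)
    (h : Lev G (j + i) x a) : ∃ c, G.Adj x c ∧ Lev G (j - 1) c z ∧ Lev G (j + i - 1) c a := by
  obtain ⟨t, rfl⟩ : ∃ t, j = t + 1 := ⟨j - 1, by omega⟩
  obtain ⟨c, hc, hcx⟩ := h1.symm.parent
  refine ⟨c, hcx.symm, hc.symm, ?_⟩
  have e : t + 1 + i = 1 + (t + i) := by ring
  rw [e] at h
  have := (h.split (near_of_adj hcx.symm) (hc.symm.1.trans h2)).2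
  rwa [show t + 1 + i - 1 = t + i by omega]

lemma geo_cycle (hℓ : 1 ≤ ℓ) {x a b : V} (ha : Lev G ℓ x a) (hb : Lev G ℓ x b)
    (hab : ∀ c, G.Adj x c → Lev G (ℓ - 1) c a → Lev G (ℓ - 1) c b → False)
    (p : G.Walk a b) (hp : p.IsPath) (hl : 1 ≤ p.length) (hs : ∀ z ∈ p.support, Lev G ℓ x z) :
    HasCycleLength G (2 * ℓ + p.length) := by
  obtain ⟨t, rfl⟩ : ∃ t, ℓ = t + 1 := ⟨ℓ - 1, by omega⟩
  obtain ⟨b', hb', hbb⟩ := hb.parent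
  obtain ⟨p1, hp1, hl1, hs1⟩ := ha.geodesic
  obtain ⟨p2, hp2, hl2, hs2⟩ := hb'.geodesic
  have k1 : (p1.append p).IsPath := by
    refine path_append _ _ hp1 hp (fun z h1 h2 => ?_)
    obtain ⟨j, i, hij, h3, h4⟩ := hs1 z h1
    have := h3.unique (hs z h2)
    obtain rfl : i = 0 := by omega
    exact lev_zero.1 h4
  have k2 : (p2.reverse.append (p1.append p)).IsPath := by
    refine path_append _ _ hp2.reverse k1 (fun z h1 h2 => ?_)
    rw [Walk.support_reverse, List.mem_reverse] at h1
    obtain ⟨j, i, hij, h3, h4⟩ := hs2 z h1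
    rw [Walk.mem_support_append_iff] at h2
    rcases h2 with h2 | h2
    · obtain ⟨j', i', hij', h3', h4'⟩ := hs1 z h2
      obtain rfl := h3.unique h3'
      by_contra hzx
      have hj : 1 ≤ j := by
        by_contra hc
        obtain rfl : j = 0 := by omega
        exact hzx (lev_zero.1 h3).symm
      obtain ⟨c, hxc, hc1, hc2⟩ := branch hj h3 h4'.1 (by rwa [hij'])
      have hbz : Lev G (j + (i + 1)) x b := by
        rwa [show j + (i + 1) = t + 1 by omega]
      have hnear := h4.1.trans (near_of_adj hbb)
      have hbz' : Lev G (1 + (j - 1 + (i + 1))) x b := by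
        rwa [show 1 + (j - 1 + (i + 1)) = t + 1 by omega]
      have := (hbz'.split (near_of_adj hxc) (hc1.1.trans hnear)).2
      refine hab c hxc ?_ ?_
      · rwa [show j + i' - 1 = t + 1 - 1 by omega] at hc2
      · rwa [show j - 1 + (i + 1) = t + 1 - 1 by omega] at this
    · have := h3.unique (hs z h2)
      omega
  have := hasCycle_of_path _ k2 hbb.symm (by simp; omega)
  convert this using 1
  simp [hl1, hl2]
  ring

/-- Levels span sparse graphs. -/
lemma sparse_lev (hG : EvenCycleFree G ℓ) (hℓ : 1 ≤ ℓ) (hk : ¬ HasCycleLength G k)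
    (hkl : 2 * ℓ + 1 ≤ k) (x : V) :
    ∑ y ∈ levs G ℓ x, ((nbr G y) ∩ levs G ℓ x).card ≤ 2 * k * (levs G ℓ x).card := by
  refine degen _ (fun T hTS hTne => ?_)
  by_contra hcon
  push Not at hcon
  obtain ⟨a, haT⟩ := hTne
  have hlev : ∀ y ∈ T, Lev G ℓ x y := fun y hy => mem_levs.1 (hTS hy)
  obtain ⟨w, p, hp, hl, hs⟩ := greedy hcon haT (k - 2 * ℓ - 1) (by omega)
  have hwT := hs w (Walk.end_mem_support p)
  have hw := hcon w hwT
  -- bad neighbours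
  set bad := (nbr G w ∩ T).filter (fun b => ∃ c, G.Adj x c ∧ Lev G (ℓ - 1) c a ∧ Lev G (ℓ - 1) c b)
    with hbad
  have hbc : bad.card ≤ 1 := by
    rw [Finset.card_le_one]
    intro b hb b' hb'
    simp only [hbad, Finset.mem_filter, Finset.mem_inter, mem_nbr] at hb hb'
    obtain ⟨⟨h1, h2⟩, c, h3, h4, h5⟩ := hb
    obtain ⟨⟨h1', h2'⟩, c', h3', h4', h5'⟩ := hb'
    have hax : Lev G (ℓ - 1 + 1) a x := by
      rw [Nat.sub_add_cancel hℓ]; exact (hlev a haT).symm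
    obtain rfl := parent_unique hG hax h4.symm h4'.symm (by omega) h3 h3'
    refine two_nbrs' hG h5 h5' (by omega) h1 h1' (fun i hi hL => ?_)
    have := (hlev w hwT).le ((near_of_adj h3).trans hL.1)
    omega
  have h1 := card_support p
  obtain ⟨b, hb, hb'⟩ := Finset.exists_mem_notMem_of_card_lt_card
    (show (p.support.toFinset ∪ bad).card < (nbr G w ∩ T).card by
      have := Finset.card_union_le p.support.toFinset bad
      omega)
  simp only [Finset.mem_union, not_or, List.mem_toFinset] at hb'
  have hb2 := hb
  simp only [Finset.mem_inter, mem_nbr] at hb2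
  have hc := geo_cycle hℓ (hlev a haT) (hlev b hb2.2) (fun c h2 h3 h4 => hb'.2 (by
    rw [hbad, Finset.mem_filter]; exact ⟨hb, c, h2, h3, h4⟩)) (p.concat hb2.1)
    (hp.concat hb'.1 hb2.1) (by simp) (fun z hz => by
      rw [Walk.support_concat] at hz
      simp at hz
      rcases hz with hz | rfl
      · exact hlev z (hs z hz)
      · exact hlev z hb2.2)
  apply hk
  convert hc using 1
  simp [hl]
  omega

end sparse
end ECF

namespace ECF
open SimpleGraph
open scoped Classical

section lin
set_option linter.unusedSectionVars false
variable {V : Type} [Fintype V] {G : SimpleGraph V} {ℓ k : ℕ} {q : ℝ}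

/-- Real indicator function of a finset. -/
noncomputable def ind (S : Finset V) : V → ℝ := fun x => if x ∈ S then 1 else 0

/-- Number of ordered adjacent pairs between `S` and `T`. -/
noncomputable def ee (G : SimpleGraph V) (S T : Finset V) : ℝ := ∑ x ∈ S, op G (ind T) x

lemma ind_nonneg (S : Finset V) (x : V) : 0 ≤ ind S x := by
  unfold ind; split_ifs <;> simp

lemma ind_le_one (S : Finset V) (x : V) : ind S x ≤ 1 := by
  unfold ind; split_ifs <;> simp

lemma ind_add_compl (S : Finset V) (x : V) : ind S x + ind Sᶜ x = 1 := by
  by_cases h : x ∈ S <;> simp [ind, h]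

lemma sum_ind_mul (S : Finset V) (f : V → ℝ) : ∑ x, ind S x * f x = ∑ x ∈ S, f x := by
  simp [ind, Finset.sum_ite_mem]

lemma sum_ind (S : Finset V) : ∑ x, ind S x = S.card := by
  simp [ind]

lemma sum_ind_on (S T : Finset V) : ∑ x ∈ S, ind T x = ((S ∩ T).card : ℝ) := by
  simp [ind]

lemma op_ind (T : Finset V) (x : V) : op G (ind T) x = ((nbr G x ∩ T).card : ℝ) := sum_ind_on _ _

lemma op_nonneg {f : V → ℝ} (hf : ∀ x, 0 ≤ f x) (x : V) : 0 ≤ op G f x :=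
  Finset.sum_nonneg (fun y _ => hf y)

lemma op_ind_nonneg (T : Finset V) (x : V) : 0 ≤ op G (ind T) x := op_nonneg (ind_nonneg T) x

lemma op_ind_add_compl (T : Finset V) (x : V) :
    op G (ind T) x + op G (ind Tᶜ) x = dg G x := by
  rw [dg_eq_op, op, op, op, ← Finset.sum_add_distrib]
  exact Finset.sum_congr rfl (fun y _ => ind_add_compl T y)

lemma op_ind_le_dg (T : Finset V) (x : V) : op G (ind T) x ≤ dg G x := by
  have := op_ind_add_compl (G := G) T x
  have := op_ind_nonneg (G := G) Tᶜ x
  linarith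

lemma ee_symm (S T : Finset V) : ee G S T = ee G T S := by
  have := op_adj (G := G) (ind T) (ind S)
  rw [sum_ind_mul] at this
  rw [ee, ee, ← this, ← sum_ind_mul]
  exact Finset.sum_congr rfl (fun x _ => mul_comm _ _)

lemma ee_nonneg (S T : Finset V) : 0 ≤ ee G S T := Finset.sum_nonneg (fun x _ => op_ind_nonneg T x)

lemma ee_add_compl (S T : Finset V) : ee G S T + ee G S Tᶜ = ∑ x ∈ S, dg G x := by
  rw [ee, ee, ← Finset.sum_add_distrib]
  exact Finset.sum_congr rfl (fun x _ => op_ind_add_compl T x)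

lemma sum_S (S : Finset V) : 2 * ∑ y ∈ S, dg G y = ∑ x, dg G x + ee G S S - ee G Sᶜ Sᶜ := by
  have h1 := ee_add_compl (G := G) S S
  have h2 := ee_add_compl (G := G) Sᶜ S
  have h3 := ee_symm (G := G) S Sᶜ
  have h4 := Finset.sum_add_sum_compl S (fun x => dg G x)
  linarith

lemma ee_cross (S : Finset V) : ∑ x, dg G x = ee G S S + ee G Sᶜ Sᶜ + 2 * ee G S Sᶜ := by
  have h1 := ee_add_compl (G := G) S S
  have h2 := ee_add_compl (G := G) Sᶜ S
  have h3 := ee_symm (G := G) S Sᶜ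
  have h4 := Finset.sum_add_sum_compl S (fun x => dg G x)
  linarith

lemma iter_nonneg {f : V → ℝ} (hf : ∀ x, 0 ≤ f x) (i : ℕ) (x : V) : 0 ≤ (op G)^[i] f x := by
  induction i generalizing x with
  | zero => simpa using hf x
  | succ i ih => rw [Function.iterate_succ_apply']; exact op_nonneg ih x

lemma iter_abs_le {f : V → ℝ} {B D : ℝ} (hB : ∀ x, |f x| ≤ B) (hD : ∀ x, dg G x ≤ D) (hB0 : 0 ≤ B)
    (i : ℕ) (x : V) : |(op G)^[i] f x| ≤ D ^ i * B := by
  have hD0 : 0 ≤ D := (dg_nonneg x).trans (hD x)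
  induction i generalizing x with
  | zero => simpa using hB x
  | succ i ih =>
    rw [Function.iterate_succ_apply']
    have := op_abs_le ih hD (by positivity) x
    calc _ ≤ _ := this
      _ = _ := by ring

lemma sum_biUnion_le' {f : V → ℝ} (hf : ∀ x, 0 ≤ f x) (S : Finset V) (t : V → Finset V) :
    ∑ z ∈ S.biUnion t, f z ≤ ∑ y ∈ S, ∑ z ∈ t y, f z := by
  induction S using Finset.induction_on with
  | empty => simp
  | insert a s ha ih =>
    rw [Finset.biUnion_insert, Finset.sum_insert ha]
    have := Finset.sum_union_inter (s₁ := t a) (s₂ := s.biUnion t) (f := f)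
    have h2 : 0 ≤ ∑ z ∈ t a ∩ s.biUnion t, f z := Finset.sum_nonneg (fun z _ => hf z)
    linarith

lemma lev_le_iter {f : V → ℝ} (hf : ∀ x, 0 ≤ f x) (i : ℕ) (x : V) :
    ∑ z ∈ levs G i x, f z ≤ (op G)^[i] f x := by
  induction i generalizing f with
  | zero => simp [levs_zero]
  | succ i ih =>
    rw [Function.iterate_succ_apply]
    refine le_trans ?_ (ih (op_nonneg hf))
    have h1 : levs G (i + 1) x ⊆ (levs G i x).biUnion (fun z => nbr G z) := by
      intro y hy
      rw [mem_levs] at hy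
      obtain ⟨z, hz, hzy⟩ := hy.parent
      simp only [Finset.mem_biUnion, mem_levs, mem_nbr]
      exact ⟨z, hz, hzy⟩
    calc _ ≤ ∑ z ∈ (levs G i x).biUnion (fun z => nbr G z), f z :=
          Finset.sum_le_sum_of_subset_of_nonneg h1 (fun z _ _ => hf z)
      _ ≤ _ := sum_biUnion_le' hf _ _

/-- Squared norms of iterates. -/
noncomputable def nrm (G : SimpleGraph V) (f : V → ℝ) (j : ℕ) : ℝ := ∑ x, ((op G)^[j] f x) ^ 2

lemma nrm_nonneg (f : V → ℝ) (j : ℕ) : 0 ≤ nrm G f j := Finset.sum_nonneg (fun x _ => sq_nonneg _)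

lemma nrm_conv (f : V → ℝ) (j : ℕ) : nrm G f (j + 1) ^ 2 ≤ nrm G f j * nrm G f (j + 2) := by
  have h : nrm G f (j + 1) = ∑ x, (op G)^[j] f x * (op G)^[j + 2] f x := by
    simp only [nrm, sq]
    rw [Function.iterate_succ_apply' (op G) (j + 1), ← op_adj, ← Function.iterate_succ_apply' (op G) j]
  rw [h]
  exact Finset.sum_mul_sq_le_sq_mul_sq _ _ _

lemma nrm_ratio (f : V → ℝ) (j : ℕ) : nrm G f 1 * nrm G f j ≤ nrm G f 0 * nrm G f (j + 1) := by
  induction j with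
  | zero => rw [mul_comm]
  | succ j ih =>
    have h1 := nrm_conv (G := G) f j
    have n1 := nrm_nonneg (G := G) f j
    have n2 := nrm_nonneg (G := G) f (j + 1)
    have n3 := nrm_nonneg (G := G) f (j + 2)
    have n4 := nrm_nonneg (G := G) f 0
    rcases eq_or_lt_of_le n2 with h0 | h0
    · rw [← h0, mul_zero]; positivity
    · have hj : 0 < nrm G f j := by
        rcases eq_or_lt_of_le n1 with h2 | h2
        · rw [← h2] at h1
          nlinarith
        · exact h2
      have : (nrm G f 1 * nrm G f (j + 1)) * nrm G f j ≤ (nrm G f 0 * nrm G f (j + 2)) * nrm G f j := by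
        nlinarith [mul_le_mul_of_nonneg_right ih n2, mul_le_mul_of_nonneg_left h1 n4]
      exact le_of_mul_le_mul_right this hj

lemma nrm_pow (f : V → ℝ) (j : ℕ) : nrm G f 1 ^ (j + 1) ≤ nrm G f (j + 1) * nrm G f 0 ^ j := by
  induction j with
  | zero => simp
  | succ j ih =>
    have n0 := nrm_nonneg (G := G) f 0
    have n1 := nrm_nonneg (G := G) f 1
    have h2 := nrm_ratio (G := G) f (j + 1)
    calc nrm G f 1 ^ (j + 1 + 1) = nrm G f 1 ^ (j + 1) * nrm G f 1 := pow_succ _ _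
      _ ≤ nrm G f (j + 1) * nrm G f 0 ^ j * nrm G f 1 := mul_le_mul_of_nonneg_right ih n1
      _ = (nrm G f 1 * nrm G f (j + 1)) * nrm G f 0 ^ j := by ring
      _ ≤ (nrm G f 0 * nrm G f (j + 1 + 1)) * nrm G f 0 ^ j :=
        mul_le_mul_of_nonneg_right h2 (by positivity)
      _ = _ := by ring

end lin
end ECF

namespace ECF
open SimpleGraph
open scoped Classical

section mix
set_option linter.unusedSectionVars false

/-- Maximum degree constant. -/
noncomputable def CC (j : ℕ) : ℝ := 3 * 8 ^ j

lemma CC_pos (j : ℕ) : 0 < CC j := by unfold CC; positivity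

lemma one_le_CC (j : ℕ) : 1 ≤ CC j := by
  unfold CC
  have : (1 : ℝ) ≤ 8 ^ j := one_le_pow₀ (by norm_num)
  linarith

variable {V : Type} [Fintype V] {G : SimpleGraph V} {j k : ℕ} {q : ℝ}

lemma Hyp.D (h : Hyp G (j + 1) q) (x : V) : dg G x ≤ CC j * q := by
  have := h.max_deg (by omega) x
  simpa [CC] using this

lemma Hyp.E_le (h : Hyp G (j + 1) q) : ∑ x, dg G x ≤ CC j * q * Fintype.card V := by
  calc _ ≤ ∑ x : V, CC j * q := Finset.sum_le_sum (fun x _ => h.D x)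
    _ = _ := by simp [mul_comm]

lemma Hyp.card1 (h : Hyp G (j + 1) q) : (Fintype.card V : ℝ) ≤ 2 * q ^ (j + 1) + 4 * q ^ j := by
  simpa using h.card_le (by omega)

lemma Hyp.card2 (h : Hyp G (j + 1) q) : (Fintype.card V : ℝ) ≤ 3 * q ^ (j + 1) :=
  h.card_le' (by omega)

/-- Constant for near-bipartiteness. -/
noncomputable def K0 (j k : ℕ) : ℝ := 4 * CC j + 12 * k + 4 * (j + 1) * CC j ^ (j + 1)

lemma K0_pos (j k : ℕ) : 0 < K0 j k := by
  unfold K0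
  have := CC_pos j
  positivity

lemma near_bip [Nonempty V] (h : Hyp G (j + 1) q) (hk : ¬ HasCycleLength G k)
    (hkl : 2 * (j + 1) + 1 ≤ k) :
    ∃ X : Finset V, ee G X X + ee G Xᶜ Xᶜ ≤ K0 j k * q ^ (j + 1) := by
  have hq := h.hq
  have hC := CC_pos j
  set m : ℝ := ((Fintype.card V : ℕ) : ℝ) with hm
  have hm0 : 0 < m := by rw [hm]; exact_mod_cast Fintype.card_pos
  set E := ∑ x, dg G x with hE
  have hE0 : 0 ≤ E := Finset.sum_nonneg (fun x _ => dg_nonneg x)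
  have hQ : 0 < q ^ j := by positivity
  have hQ1 : q ^ (j + 1) = q ^ j * q := pow_succ _ _
  have h2 := h.card2
  have hss : ∀ x, ee G (levs G (j + 1) x) (levs G (j + 1) x) ≤ 2 * k * m := by
    intro x
    have h1 := sparse_lev h.free (by omega) hk hkl x
    have h3 : ((levs G (j + 1) x).card : ℝ) ≤ m := by
      rw [hm]; exact_mod_cast Finset.card_le_univ _
    calc ee G (levs G (j + 1) x) (levs G (j + 1) x) =
        ((∑ y ∈ levs G (j + 1) x, ((nbr G y) ∩ levs G (j + 1) x).card : ℕ) : ℝ) := by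
          push_cast
          exact Finset.sum_congr rfl (fun y _ => op_ind _ _)
      _ ≤ ((2 * k * (levs G (j + 1) x).card : ℕ) : ℝ) := by exact_mod_cast h1
      _ = 2 * k * (levs G (j + 1) x).card := by push_cast; ring
      _ ≤ _ := by gcongr
  have hiter : ∑ x, (op G)^[j + 1 + 1] (fun _ => 1) x - 2 * (j + 1) * (CC j * q) ^ (j + 1) * m ≤
      ∑ x, ∑ y ∈ levs G (j + 1) x, dg G y := by
    have : ∀ x, (op G)^[j + 1 + 1] (fun _ => 1) x - 2 * (j + 1) * (CC j * q) ^ (j + 1) ≤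
        ∑ y ∈ levs G (j + 1) x, dg G y := by
      intro x
      have h3 := op_iter h.free (h.D) (le_refl (j + 1)) x (f := fun x => dg G x) (B := CC j * q)
        (fun x => by rw [abs_of_nonneg (dg_nonneg x)]; exact h.D x) (by positivity)
      have h4 : (fun x => dg G x) = op G (fun _ => 1) := funext (fun x => dg_eq_op x)
      rw [Function.iterate_succ_apply, ← h4]
      have := (abs_le.1 h3).2
      simp only [Nat.add_sub_cancel] at this
      push_cast at this
      rw [pow_succ]
      linarith
    calc _ = ∑ x, ((op G)^[j + 1 + 1] (fun _ => 1) x - 2 * (j + 1) * (CC j * q) ^ (j + 1)) := by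
          rw [Finset.sum_sub_distrib]
          simp [hm]
          ring
      _ ≤ _ := Finset.sum_le_sum (fun x _ => this x)
  have hw := walk_sum h.two_le (by linarith) h.hs (j + 1)
  have hEle := h.E_le
  have h1 := h.card1
  rw [← hm] at h1 h2 hEle
  rw [← hE] at hEle hw
  have hkey : ∃ x, ee G (levs G (j + 1) x)ᶜ (levs G (j + 1) x)ᶜ ≤
      (4 * CC j + 6 * k + 4 * (j + 1) * CC j ^ (j + 1)) * q ^ (j + 1) := by
    by_contra hc
    push Not at hc
    have h3 : ∀ x, 2 * ∑ y ∈ levs G (j + 1) x, dg G y ≤ E + 2 * k * m -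
        (4 * CC j + 6 * k + 4 * (j + 1) * CC j ^ (j + 1)) * q ^ (j + 1) := by
      intro x
      have := sum_S (G := G) (levs G (j + 1) x)
      have := hss x
      have := hc x
      linarith
    obtain ⟨x0⟩ := (inferInstance : Nonempty V)
    have h3' : ∑ x : V, 2 * ∑ y ∈ levs G (j + 1) x, dg G y < ∑ x : V, (E + 2 * k * m -
        (4 * CC j + 6 * k + 4 * (j + 1) * CC j ^ (j + 1)) * q ^ (j + 1)) := by
      refine Finset.sum_lt_sum (fun x _ => h3 x) ⟨x0, Finset.mem_univ _, ?_⟩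
      have := sum_S (G := G) (levs G (j + 1) x0)
      have := hss x0
      have := hc x0
      linarith
    rw [← Finset.mul_sum] at h3'
    simp only [Finset.sum_const, Finset.card_univ, nsmul_eq_mul, ← hm] at h3'
    have e1 : E * (m - 2 * q ^ (j + 1)) ≤ CC j * q * m * (4 * q ^ j) := by
      calc E * (m - 2 * q ^ (j + 1)) ≤ E * (4 * q ^ j) := by
            apply mul_le_mul_of_nonneg_left _ hE0; linarith
        _ ≤ _ := mul_le_mul_of_nonneg_right hEle (by positivity)
    have e2 : 2 * (k : ℝ) * m * m ≤ 2 * k * m * (3 * q ^ (j + 1)) := by gcongr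
    rw [mul_pow] at hiter
    rw [hQ1] at *
    have e3 : CC j * q * m * (4 * q ^ j) = 4 * CC j * (q ^ j * q) * m := by ring
    nlinarith
  obtain ⟨x, hx⟩ := hkey
  refine ⟨levs G (j + 1) x, ?_⟩
  have h3 := hss x
  have h4 : 2 * (k : ℝ) * m ≤ 2 * k * (3 * q ^ (j + 1)) := by gcongr
  unfold K0
  linarith

/-- The side reached by walks of the wrong parity. -/
noncomputable def bad (i : ℕ) (X : Finset V) : Finset V := if Even i then Xᶜ else X

lemma bad_compl (i : ℕ) (X : Finset V) : bad i Xᶜ = (bad i X)ᶜ := by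
  unfold bad; split_ifs <;> simp

lemma bad_succ (i : ℕ) (X : Finset V) : bad i X = (bad (i + 1) X)ᶜ := by
  unfold bad
  by_cases h : Even i
  · simp [h, Nat.even_add_one]
  · simp [h, Nat.even_add_one]

lemma ee_bad_le (i : ℕ) (X : Finset V) : ee G (bad i X) (bad i X) ≤ ee G X X + ee G Xᶜ Xᶜ := by
  have h1 := ee_nonneg (G := G) X X
  have h2 := ee_nonneg (G := G) Xᶜ Xᶜ
  unfold bad
  split_ifs <;> linarith

lemma wrong_iter {D : ℝ} (hD : ∀ x, dg G x ≤ D) (hD0 : 0 ≤ D) (X : Finset V) (i : ℕ) :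
    ∑ x ∈ bad (i + 1) X, (op G)^[i + 1] (ind X) x ≤
      (i + 1) * (ee G X X + ee G Xᶜ Xᶜ) * D ^ i := by
  set β := ee G X X + ee G Xᶜ Xᶜ with hβ
  have hβ0 : 0 ≤ β := add_nonneg (ee_nonneg _ _) (ee_nonneg _ _)
  have step : ∀ i, ∑ x ∈ bad (i + 1) X, (op G)^[i + 1] (ind X) x ≤
      β * D ^ i + D * ∑ x ∈ bad i X, (op G)^[i] (ind X) x := by
    intro i
    set g := (op G)^[i] (ind X) with hg
    have hg0 : ∀ x, 0 ≤ g x := iter_nonneg (ind_nonneg X) i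
    have hg1 : ∀ x, g x ≤ D ^ i := by
      intro x
      have := iter_abs_le (G := G) (f := ind X) (B := 1) (fun x => by
        rw [abs_of_nonneg (ind_nonneg X x)]; exact ind_le_one X x) hD (by norm_num) i x
      have := (abs_le.1 this).2
      linarith
    set P := bad (i + 1) X with hP
    have h1 : ∑ x ∈ P, (op G)^[i + 1] (ind X) x = ∑ x, op G (ind P) x * g x := by
      rw [op_adj, sum_ind_mul]
      simp_rw [Function.iterate_succ_apply']
      rfl
    rw [h1, ← Finset.sum_add_sum_compl P, bad_succ, ← hP, Finset.mul_sum]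
    refine add_le_add ?_ ?_
    · calc ∑ x ∈ P, op G (ind P) x * g x ≤ ∑ x ∈ P, op G (ind P) x * D ^ i :=
            Finset.sum_le_sum (fun x _ => mul_le_mul_of_nonneg_left (hg1 x) (op_ind_nonneg P x))
        _ = ee G P P * D ^ i := by rw [← Finset.sum_mul]; rfl
        _ ≤ _ := mul_le_mul_of_nonneg_right (ee_bad_le _ X) (by positivity)
    · exact Finset.sum_le_sum (fun x _ => mul_le_mul_of_nonneg_right
        ((op_ind_le_dg P x).trans (hD x)) (hg0 x))
  induction i with
  | zero =>
    have := step 0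
    have h0 : ∑ x ∈ bad 0 X, (op G)^[0] (ind X) x = 0 := by
      refine Finset.sum_eq_zero (fun x hx => ?_)
      simp [bad] at hx
      simp [ind, hx]
    rw [h0] at this
    simpa using this
  | succ i ih =>
    have h1 := step (i + 1)
    have h2 := mul_le_mul_of_nonneg_left ih hD0
    push_cast
    calc _ ≤ _ := h1
      _ ≤ β * D ^ (i + 1) + D * ((i + 1) * β * D ^ i) := by linarith
      _ = _ := by ring

/-- `|X ∩ N_ℓ(x)|`. -/
noncomputable def sl (G : SimpleGraph V) (i : ℕ) (X : Finset V) (x : V) : ℝ :=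
  ∑ z ∈ levs G i x, ind X z

lemma sl_nonneg (i : ℕ) (X : Finset V) (x : V) : 0 ≤ sl G i X x :=
  Finset.sum_nonneg (fun z _ => ind_nonneg X z)

lemma sl_add (i : ℕ) (X : Finset V) (x : V) :
    sl G i X x + sl G i Xᶜ x = (levs G i x).card := by
  rw [sl, sl, ← Finset.sum_add_distrib, Finset.sum_congr rfl (fun z _ => ind_add_compl X z)]
  simp

lemma wrong_sl {D : ℝ} (hD : ∀ x, dg G x ≤ D) (hD0 : 0 ≤ D) (X : Finset V) (i : ℕ) :
    ∑ x ∈ bad (i + 1) X, sl G (i + 1) X x ≤ (i + 1) * (ee G X X + ee G Xᶜ Xᶜ) * D ^ i :=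
  le_trans (Finset.sum_le_sum (fun x _ => lev_le_iter (ind_nonneg X) (i + 1) x))
    (wrong_iter hD hD0 X i)

/-- The discrepancy functional. -/
noncomputable def disc (G : SimpleGraph V) (i : ℕ) (X : Finset V) : ℝ :=
  ∑ x ∈ (bad i X)ᶜ, (X.card - sl G i X x) + ∑ x ∈ bad i X, sl G i X x

lemma sum_f_le (i : ℕ) (X : Finset V) {f : V → ℝ} (hf : ∀ x, |f x| ≤ ind X x)
    (hf0 : ∑ x, f x = 0) : ∑ x, |∑ z ∈ levs G i x, f z| ≤ disc G i X := by
  rw [disc, ← Finset.sum_add_sum_compl (bad i X), add_comm]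
  refine add_le_add (Finset.sum_le_sum (fun x _ => ?_)) (Finset.sum_le_sum (fun x _ => ?_))
  · have h1 : ∑ z ∈ levs G i x, f z = - ∑ z ∈ (levs G i x)ᶜ, f z := by
      have := Finset.sum_add_sum_compl (levs G i x) f
      linarith
    have h2 : (X.card : ℝ) - sl G i X x = ∑ z ∈ (levs G i x)ᶜ, ind X z := by
      have := Finset.sum_add_sum_compl (levs G i x) (ind X)
      rw [sum_ind] at this
      rw [sl]
      linarith
    rw [h1, abs_neg, h2]
    exact (Finset.abs_sum_le_sum_abs _ _).trans (Finset.sum_le_sum (fun z _ => hf z))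
  · exact (Finset.abs_sum_le_sum_abs _ _).trans (Finset.sum_le_sum (fun z _ => hf z))

lemma disc_nonneg_part (i : ℕ) (X : Finset V) :
    0 ≤ ∑ x ∈ (bad i X)ᶜ, ((X.card : ℝ) - sl G i X x) := by
  refine Finset.sum_nonneg (fun x _ => ?_)
  have : sl G i X x ≤ X.card := by
    rw [← sum_ind, sl]
    exact Finset.sum_le_sum_of_subset_of_nonneg (Finset.subset_univ _) (fun z _ _ => ind_nonneg X z)
  linarith

/-- Number of right pairs. -/
noncomputable def RP (i : ℕ) (X : Finset V) : ℝ :=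
  ((bad i X)ᶜ.card : ℝ) * X.card + ((bad i Xᶜ)ᶜ.card : ℝ) * Xᶜ.card

lemma disc_le {D : ℝ} (hD : ∀ x, dg G x ≤ D) (hD0 : 0 ≤ D) (X : Finset V) (i : ℕ) :
    disc G (i + 1) X ≤ RP (i + 1) X - ∑ x, ((levs G (i + 1) x).card : ℝ) +
      4 * ((i + 1) * (ee G X X + ee G Xᶜ Xᶜ) * D ^ i) := by
  have w1 := wrong_sl hD hD0 X i
  have w2 := wrong_sl hD hD0 Xᶜ i
  rw [compl_compl, add_comm (ee G Xᶜ Xᶜ)] at w2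
  have hn := disc_nonneg_part (G := G) (i + 1) Xᶜ
  have hT : ∑ x, ((levs G (i + 1) x).card : ℝ) =
      (∑ x ∈ bad (i + 1) X, sl G (i + 1) X x + ∑ x ∈ (bad (i + 1) X)ᶜ, sl G (i + 1) X x) +
      (∑ x ∈ bad (i + 1) Xᶜ, sl G (i + 1) Xᶜ x + ∑ x ∈ (bad (i + 1) Xᶜ)ᶜ, sl G (i + 1) Xᶜ x) := by
    rw [Finset.sum_add_sum_compl, Finset.sum_add_sum_compl, ← Finset.sum_add_distrib]
    exact Finset.sum_congr rfl (fun x _ => (sl_add _ _ _).symm)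
  rw [hT]
  unfold disc RP
  rw [Finset.sum_sub_distrib] at hn ⊢
  simp only [Finset.sum_const, nsmul_eq_mul] at hn ⊢
  have hβ : 0 ≤ (i + 1) * (ee G X X + ee G Xᶜ Xᶜ) * D ^ i := by
    have := add_nonneg (ee_nonneg (G := G) X X) (ee_nonneg (G := G) Xᶜ Xᶜ)
    positivity
  linarith

end mix
end ECF

namespace ECF
open SimpleGraph
open scoped Classical

section pseudo
set_option linter.unusedSectionVars false
variable {V : Type} [Fintype V] {G : SimpleGraph V} {j k : ℕ} {q : ℝ}

lemma pow2 (q : ℝ) (j : ℕ) : q ^ (2 * j + 1) = q ^ j * q ^ (j + 1) := by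
  rw [← pow_add]; congr 1; omega

lemma T_lower (h : Hyp G (j + 1) q) :
    (Fintype.card V : ℝ) ^ 2 / 2 - (6 + 6 * (j + 1) * CC j ^ j) * q ^ (2 * j + 1) ≤
      ∑ x, ((levs G (j + 1) x).card : ℝ) := by
  have hq := h.hq
  have hC := CC_pos j
  have h1 := h.card1
  have h2 := h.card2
  have hs := h.hs
  have hw := walk_sum h.two_le (by linarith) h.hs j
  set m : ℝ := ((Fintype.card V : ℕ) : ℝ) with hm
  have hm0 : 0 ≤ m := by rw [hm]; positivity
  have hQ : 0 < q ^ j := by positivity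
  have h3 : ∑ x, (op G)^[j + 1] (fun _ => 1) x ≤
      ∑ x, (((levs G (j + 1) x).card : ℝ) + 2 * (j + 1) * (CC j * q) ^ j) := by
    refine Finset.sum_le_sum (fun x _ => ?_)
    have := op_iter h.free (h.D) (le_refl (j + 1)) x (f := fun _ => (1:ℝ)) (B := 1)
      (fun x => by simp) (by norm_num)
    have := (abs_le.1 this).2
    simp only [Nat.add_sub_cancel, Finset.sum_const, nsmul_eq_mul, mul_one] at this
    push_cast at this
    linarith
  rw [Finset.sum_add_distrib] at h3
  simp only [Finset.sum_const, Finset.card_univ, nsmul_eq_mul, ← hm] at h3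
  have h4 : q ^ j * (q * m) ≤ q ^ j * ∑ x, dg G x := by
    apply mul_le_mul_of_nonneg_left _ hQ.le
    linarith
  have h5 : m * m ≤ m * (2 * q ^ (j + 1) + 4 * q ^ j) := mul_le_mul_of_nonneg_left h1 hm0
  have h6 : q ^ j * m ≤ q ^ j * (3 * q ^ (j + 1)) := mul_le_mul_of_nonneg_left h2 hQ.le
  have h7 : (2 * (j + 1) * CC j ^ j) * (q ^ j * m) ≤
      (2 * (j + 1) * CC j ^ j) * (q ^ j * (3 * q ^ (j + 1))) :=
    mul_le_mul_of_nonneg_left h6 (by positivity)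
  rw [mul_pow] at h3
  rw [pow2]
  have e : q ^ (j + 1) = q ^ j * q := pow_succ _ _
  rw [e] at h1 h2 h5 h6 h7 ⊢
  nlinarith

lemma card_add (X : Finset V) : (X.card : ℝ) + (Xᶜ.card : ℝ) = Fintype.card V := by
  exact_mod_cast Finset.card_add_card_compl X

/-- Constant for the number of right pairs. -/
noncomputable def K1 (j k : ℕ) : ℝ := 4 * K0 j k + 12 * CC j

lemma c4_bound (h : Hyp G (1 + 1) q) (X : Finset V) :
    ee G X Xᶜ ^ 2 ≤ X.card * Xᶜ.card * (X.card + 4 * (CC 1 * q)) := by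
  have h1 : ∑ y, op G (ind X) y ^ 2 ≤ X.card * (X.card + 4 * (CC 1 * q)) := by
    calc ∑ y, op G (ind X) y ^ 2 = ∑ y, op G (ind X) y * op G (ind X) y :=
          Finset.sum_congr rfl (fun y _ => by ring)
      _ = ∑ x ∈ X, op G (op G (ind X)) x := by rw [op_adj, sum_ind_mul]
      _ ≤ ∑ x ∈ X, ((X.card : ℝ) + 4 * (CC 1 * q)) := by
          refine Finset.sum_le_sum (fun x _ => ?_)
          have := op_iter h.free (h.D) (le_refl (1 + 1)) x (f := ind X) (B := 1)
            (fun x => by rw [abs_of_nonneg (ind_nonneg X x)]; exact ind_le_one X x) (by norm_num)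
          have := (abs_le.1 this).2
          have h3 : ∑ z ∈ levs G 2 x, ind X z ≤ X.card := by
            rw [← sum_ind]
            exact Finset.sum_le_sum_of_subset_of_nonneg (Finset.subset_univ _)
              (fun z _ _ => ind_nonneg X z)
          simp only [Function.iterate_succ, Function.iterate_zero, Function.comp] at this
          norm_num at this
          linarith
      _ = _ := by rw [Finset.sum_const, nsmul_eq_mul]
  have h2 : (∑ y ∈ Xᶜ, op G (ind X) y) ^ 2 ≤ (Xᶜ.card : ℝ) * ∑ y ∈ Xᶜ, op G (ind X) y ^ 2 :=
    sq_sum_le_card_mul_sum_sq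
  have h3 : ∑ y ∈ Xᶜ, op G (ind X) y ^ 2 ≤ ∑ y, op G (ind X) y ^ 2 :=
    Finset.sum_le_sum_of_subset_of_nonneg (Finset.subset_univ _) (fun z _ _ => sq_nonneg _)
  rw [ee_symm]
  calc _ ≤ _ := h2
    _ ≤ (Xᶜ.card : ℝ) * (X.card * (X.card + 4 * (CC 1 * q))) :=
        mul_le_mul_of_nonneg_left (h3.trans h1) (by positivity)
    _ = _ := by ring

lemma RP_le [Nonempty V] (h : Hyp G (j + 1) q) (hj : Even j ∨ j = 1) (X : Finset V)
    (hX : ee G X X + ee G Xᶜ Xᶜ ≤ K0 j k * q ^ (j + 1)) :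
    RP (j + 1) X ≤ (Fintype.card V : ℝ) ^ 2 / 2 + K1 j k * q ^ (2 * j + 1) := by
  have hq := h.hq
  have hC := CC_pos j
  have hK := K0_pos j k
  have hadd := card_add X
  rcases hj with hj | rfl
  · have e : RP (j + 1) X = 2 * (X.card * Xᶜ.card) := by
      simp only [RP, bad, Nat.even_add_one, hj, not_true, if_false, compl_compl]
      ring
    rw [e, ← hadd]
    have : 0 ≤ K1 j k * q ^ (2 * j + 1) := by unfold K1; positivity
    nlinarith [sq_nonneg ((X.card : ℝ) - Xᶜ.card)]
  · have e : RP (1 + 1) X = (X.card : ℝ) ^ 2 + (Xᶜ.card : ℝ) ^ 2 := by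
      simp [RP, bad]
      ring
    have c1 := c4_bound h X
    have c2 := c4_bound h Xᶜ
    rw [compl_compl, ee_symm] at c2
    have hc := ee_cross (G := G) X
    have hs := h.hs
    have hm := h.hm
    have h2 := h.card2
    rw [e]
    set m : ℝ := ((Fintype.card V : ℕ) : ℝ) with hmm
    have hm0 : 0 < m := by rw [hmm]; exact_mod_cast Fintype.card_pos
    have he0 := ee_nonneg (G := G) X Xᶜ
    set e' := ee G X Xᶜ
    set x : ℝ := (X.card : ℝ)
    set y : ℝ := (Xᶜ.card : ℝ)
    have hx : 0 ≤ x := by positivity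
    have hy : 0 ≤ y := by positivity
    simp only [Finset.sum_range_succ, Finset.sum_range_zero] at hm
    have hm2 : m ≤ 2 * (q + 1) ^ 2 := by
      rw [pow_zero, pow_one, one_add_one_eq_two] at hm
      nlinarith
    set K := K0 1 k
    set C := CC 1
    have a1 : (q + 1) * m - K * q ^ 2 ≤ 2 * e' := by norm_num at hX; linarith
    have hB : 0 ≤ K * q ^ 2 := by positivity
    have hA : 0 ≤ (q + 1) * m := by positivity
    have a2 : ((q + 1) * m) ^ 2 - 2 * ((q + 1) * m) * (K * q ^ 2) ≤ 4 * e' ^ 2 := by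
      rcases le_total (K * q ^ 2) ((q + 1) * m) with hh | hh
      · nlinarith
      · nlinarith
    have a3 : 2 * e' ^ 2 ≤ (x * y) * (m + 8 * (C * q)) := by
      rw [← hadd]; nlinarith
    have a4 : 4 * (x * y) ≤ m ^ 2 := by
      rw [← hadd]; nlinarith [sq_nonneg (x - y)]
    have a5 : 4 * (x * y) * (8 * (C * q)) ≤ m ^ 2 * (8 * (C * q)) :=
      mul_le_mul_of_nonneg_right a4 (by positivity)
    have a6 : m * (2 * (q + 1) ^ 2 * m - 4 * (q + 1) * K * q ^ 2 - 8 * C * q * m) ≤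
        m * (4 * (x * y)) := by nlinarith
    have a7 := le_of_mul_le_mul_left a6 hm0
    have a8 : m * m ≤ 2 * (q + 1) ^ 2 * m := mul_le_mul_of_nonneg_right hm2 hm0.le
    have a9 : 8 * C * q * m ≤ 8 * C * q * (3 * q ^ 2) := by
      norm_num at h2
      exact mul_le_mul_of_nonneg_left h2 (by positivity)
    have a10 : 4 * (q + 1) * (K * q ^ 2) ≤ 4 * (2 * q) * (K * q ^ 2) :=
      mul_le_mul_of_nonneg_right (by linarith) hB
    have : K1 1 k = 4 * K + 12 * C := rfl
    rw [this]
    norm_num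
    have a11 : (x + y) ^ 2 = m ^ 2 := by rw [hadd]
    nlinarith

/-- Constant for `L¹` norm. -/
noncomputable def K3 (j k : ℕ) : ℝ := K1 j k + (6 + 6 * (j + 1) * CC j ^ j) +
  4 * ((j + 1) * K0 j k * CC j ^ j) + 6 * (j + 1) * CC j ^ j

lemma K3_pos (j k : ℕ) : 0 < K3 j k := by
  have := CC_pos j
  have := K0_pos j k
  unfold K3 K1
  positivity

lemma L1_le [Nonempty V] (h : Hyp G (j + 1) q) (hj : Even j ∨ j = 1) (X : Finset V)
    (hX : ee G X X + ee G Xᶜ Xᶜ ≤ K0 j k * q ^ (j + 1)) {f : V → ℝ} (hf : ∀ x, |f x| ≤ ind X x)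
    (hf0 : ∑ x, f x = 0) :
    ∑ x, |(op G)^[j + 1] f x| ≤ K3 j k * q ^ (2 * j + 1) := by
  have hq := h.hq
  have hC := CC_pos j
  have h1 := sum_f_le (G := G) (j + 1) X hf hf0
  have h2 := disc_le h.D (by positivity) X j
  have h3 := RP_le h hj X hX
  have h4 := T_lower h
  have hQ : 0 < q ^ j := by positivity
  have h5 : (ee G X X + ee G Xᶜ Xᶜ) * ((j + 1) * (CC j * q) ^ j) ≤
      (K0 j k * q ^ (j + 1)) * ((j + 1) * (CC j * q) ^ j) :=
    mul_le_mul_of_nonneg_right hX (by positivity)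
  have h6 : ∑ x, |(op G)^[j + 1] f x| ≤
      ∑ x, (|∑ z ∈ levs G (j + 1) x, f z| + 2 * (j + 1) * (CC j * q) ^ j) := by
    refine Finset.sum_le_sum (fun x _ => ?_)
    have := op_iter h.free (h.D) (le_refl (j + 1)) x (f := f) (B := 1)
      (fun x => (hf x).trans (ind_le_one X x)) (by norm_num)
    simp only [Nat.add_sub_cancel, mul_one] at this
    push_cast at this
    have t := abs_sub_abs_le_abs_sub ((op G)^[j + 1] f x) (∑ z ∈ levs G (j + 1) x, f z)
    linarith
  rw [Finset.sum_add_distrib] at h6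
  simp only [Finset.sum_const, Finset.card_univ, nsmul_eq_mul] at h6
  have h7 : (2 * (j + 1) * (CC j * q) ^ j) * (Fintype.card V : ℝ) ≤
      (2 * (j + 1) * (CC j * q) ^ j) * (3 * q ^ (j + 1)) :=
    mul_le_mul_of_nonneg_left h.card2 (by positivity)
  unfold K3
  rw [pow2] at *
  rw [mul_pow] at *
  nlinarith

/-- Constant for the second moment. -/
noncomputable def K5 (j k : ℕ) : ℝ := CC j ^ (j + 1) * K3 j k * 3 ^ j

lemma K5_pos (j k : ℕ) : 0 < K5 j k := by
  have := CC_pos j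
  have := K3_pos j k
  unfold K5
  positivity

lemma nrm_le [Nonempty V] (h : Hyp G (j + 1) q) (hj : Even j ∨ j = 1) (X : Finset V)
    (hX : ee G X X + ee G Xᶜ Xᶜ ≤ K0 j k * q ^ (j + 1)) {f : V → ℝ} (hf : ∀ x, |f x| ≤ ind X x)
    (hf0 : ∑ x, f x = 0) :
    nrm G f 1 ^ (j + 1) ≤ K5 j k * q ^ (j * j + 4 * j + 2) := by
  have hq := h.hq
  have hC := CC_pos j
  have hL := L1_le h hj X hX hf hf0
  have hf1 : ∀ x, |f x| ≤ 1 := fun x => (hf x).trans (ind_le_one X x)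
  have h1 : nrm G f (j + 1) ≤ (CC j * q) ^ (j + 1) * (K3 j k * q ^ (2 * j + 1)) := by
    refine le_trans ?_ (mul_le_mul_of_nonneg_left hL (by positivity))
    rw [Finset.mul_sum, nrm]
    refine Finset.sum_le_sum (fun x _ => ?_)
    have := iter_abs_le hf1 h.D (by norm_num) (j + 1) x
    rw [mul_one] at this
    rw [← sq_abs, sq]
    exact mul_le_mul_of_nonneg_right this (abs_nonneg _)
  have h0 : nrm G f 0 ≤ 3 * q ^ (j + 1) := by
    refine le_trans ?_ h.card2
    rw [nrm]
    calc _ ≤ ∑ x : V, (1 : ℝ) := Finset.sum_le_sum (fun x _ => by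
            simpa using hf1 x)
      _ = _ := by simp
  calc _ ≤ _ := nrm_pow f j
    _ ≤ ((CC j * q) ^ (j + 1) * (K3 j k * q ^ (2 * j + 1))) * (3 * q ^ (j + 1)) ^ j := by
        have := nrm_nonneg (G := G) f 0
        have := K3_pos j k
        gcongr
    _ = K5 j k * q ^ (j * j + 4 * j + 2) := by
        unfold K5
        rw [mul_pow, mul_pow, ← pow_mul]
        have : q ^ (j * j + 4 * j + 2) = q ^ (j + 1) * q ^ (2 * j + 1) * q ^ ((j + 1) * j) := by
          rw [← pow_add, ← pow_add]; congr 1; ring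
        rw [this]; ring

lemma nrm_small [Nonempty V] (h : Hyp G (j + 1) q) (hj : Even j ∨ j = 1) (X : Finset V)
    (hX : ee G X X + ee G Xᶜ Xᶜ ≤ K0 j k * q ^ (j + 1)) {f : V → ℝ} (hf : ∀ x, |f x| ≤ ind X x)
    (hf0 : ∑ x, f x = 0) {η : ℝ} (hη : 0 < η) (hqη : K5 j k / η ^ (j + 1) ≤ q) :
    nrm G f 1 ≤ η * q ^ (j + 3) := by
  have hq := h.hq
  have h1 := nrm_le h hj X hX hf hf0
  rw [← pow_le_pow_iff_left₀ (nrm_nonneg f 1) (by positivity) (Nat.succ_ne_zero j)]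
  refine h1.trans ?_
  rw [div_le_iff₀ (by positivity)] at hqη
  calc K5 j k * q ^ (j * j + 4 * j + 2) ≤ (q * η ^ (j + 1)) * q ^ (j * j + 4 * j + 2) := by gcongr
    _ = _ := by
      rw [mul_pow, ← pow_mul]
      have : q ^ ((j + 3) * (j + 1)) = q * q ^ (j * j + 4 * j + 2) := by
        rw [← pow_succ']; congr 1; ring
      rw [Nat.succ_eq_add_one, this]; ring

/-- Expansion from `X` to its complement. -/
def Expd (G : SimpleGraph V) (c ε q : ℝ) (ℓ : ℕ) (X : Finset V) : Prop :=
  ∀ W ⊆ X, c * q ^ ℓ ≤ W.card →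
    ((Xᶜ.filter (fun y => op G (ind W) y < c / 48 * q)).card : ℝ) ≤ ε * q ^ ℓ

lemma expd [Nonempty V] (h : Hyp G (j + 1) q) (hj : Even j ∨ j = 1) (X : Finset V)
    (hX : ee G X X + ee G Xᶜ Xᶜ ≤ K0 j k * q ^ (j + 1)) {c ε : ℝ} (hc : 0 < c) (hε : 0 < ε)
    (h1 : 16 * K0 j k / ε ≤ q) (h2 : K5 j k / (ε * c ^ 2 / (2 * 48 ^ 2)) ^ (j + 1) ≤ q) :
    Expd G c ε q (j + 1) X := by
  intro W hWX hW
  have hq := h.hq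
  have hQ : 0 < q ^ j := by positivity
  have hWp : (0 : ℝ) < W.card := lt_of_lt_of_le (by positivity) hW
  have hWX' : (W.card : ℝ) ≤ X.card := by exact_mod_cast Finset.card_le_card hWX
  have hXp : (0 : ℝ) < X.card := by linarith
  set t : ℝ := W.card / X.card with ht
  have ht0 : 0 < t := by positivity
  have ht1 : t ≤ 1 := by rw [ht, div_le_one hXp]; exact hWX'
  have htX : t * X.card = W.card := by rw [ht]; field_simp
  have htc : c / 3 ≤ t := by
    rw [ht, le_div_iff₀ hXp]
    have h3 := h.card2
    have h4 : (X.card : ℝ) ≤ Fintype.card V := by exact_mod_cast Finset.card_le_univ _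
    have : c / 3 * X.card ≤ c / 3 * (3 * q ^ (j + 1)) := by
      apply mul_le_mul_of_nonneg_left _ (by positivity); linarith
    linarith
  set f : V → ℝ := fun x => ind W x + (-t) * ind X x with hf
  have hfX : ∀ x, |f x| ≤ ind X x := by
    intro x
    simp only [hf, ind]
    by_cases hx : x ∈ W
    · simp only [hx, hWX hx, if_true]
      rw [abs_le]; constructor <;> linarith
    · by_cases hx' : x ∈ X
      · simp only [hx, hx', if_true, if_false]
        rw [abs_le]; constructor <;> linarith
      · simp [hx, hx']
  have hf0 : ∑ x, f x = 0 := by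
    simp only [hf]
    rw [Finset.sum_add_distrib, ← Finset.mul_sum, sum_ind, sum_ind]
    linarith
  have hn := nrm_small h hj X hX hfX hf0 (η := ε * c ^ 2 / (2 * 48 ^ 2)) (by positivity) h2
  have hop : ∀ y, op G f y = op G (ind W) y - t * op G (ind X) y := by
    intro y
    simp only [op, hf, Finset.sum_add_distrib, ← Finset.mul_sum]
    ring
  set Z := Xᶜ.filter (fun y => op G (ind W) y < c / 48 * q) with hZ
  set Z1 := Z.filter (fun y => q / 8 < op G (ind Xᶜ) y) with hZ1
  set Z2 := Z.filter (fun y => ¬ q / 8 < op G (ind Xᶜ) y) with hZ2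
  have hcard : (Z.card : ℝ) = Z1.card + Z2.card := by
    exact_mod_cast (Finset.card_filter_add_card_filter_not (s := Z) _).symm
  have b1 : (Z1.card : ℝ) * (q / 8) ≤ K0 j k * q ^ (j + 1) := by
    calc (Z1.card : ℝ) * (q / 8) = ∑ y ∈ Z1, q / 8 := by simp
      _ ≤ ∑ y ∈ Z1, op G (ind Xᶜ) y :=
          Finset.sum_le_sum (fun y hy => (Finset.mem_filter.1 hy).2.le)
      _ ≤ ∑ y ∈ Xᶜ, op G (ind Xᶜ) y := Finset.sum_le_sum_of_subset_of_nonneg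
          ((Finset.filter_subset _ _).trans (Finset.filter_subset _ _))
          (fun z _ _ => op_ind_nonneg _ _)
      _ = ee G Xᶜ Xᶜ := rfl
      _ ≤ _ := by have := ee_nonneg (G := G) X X; linarith
  have b1' : (Z1.card : ℝ) ≤ ε / 2 * q ^ (j + 1) := by
    rw [div_le_iff₀ hε] at h1
    have : (Z1.card : ℝ) * (q / 8) ≤ (ε / 2 * q ^ (j + 1)) * (q / 8) := by
      refine b1.trans ?_
      have : K0 j k ≤ q * ε / 16 := by linarith
      calc _ ≤ q * ε / 16 * q ^ (j + 1) := by gcongr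
        _ = _ := by ring
    exact le_of_mul_le_mul_right this (by positivity)
  have b2 : (Z2.card : ℝ) * (c * q / 48) ^ 2 ≤ ε * c ^ 2 / (2 * 48 ^ 2) * q ^ (j + 3) := by
    refine le_trans ?_ hn
    calc (Z2.card : ℝ) * (c * q / 48) ^ 2 = ∑ y ∈ Z2, (c * q / 48) ^ 2 := by simp
      _ ≤ ∑ y ∈ Z2, ((op G)^[1] f y) ^ 2 := by
          refine Finset.sum_le_sum (fun y hy => ?_)
          rw [Function.iterate_one, hop]
          have y1 := (Finset.mem_filter.1 hy).2
          have y2 := (Finset.mem_filter.1 ((Finset.mem_filter.1 hy).1)).2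
          have y3 := op_ind_add_compl (G := G) X y
          have y4 := h.hd y
          have y5 : q / 8 ≤ op G (ind X) y := by linarith
          have y6 : c / 3 * (q / 8) ≤ t * op G (ind X) y := by gcongr
          have : c * q / 48 ≤ -(op G (ind W) y - t * op G (ind X) y) := by linarith
          rw [← neg_sq (op G (ind W) y - t * op G (ind X) y)]
          exact pow_le_pow_left₀ (by positivity) this 2
      _ ≤ _ := Finset.sum_le_sum_of_subset_of_nonneg (Finset.subset_univ _)
          (fun z _ _ => sq_nonneg _)
  have b2' : (Z2.card : ℝ) ≤ ε / 2 * q ^ (j + 1) := by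
    have : (Z2.card : ℝ) * (c * q / 48) ^ 2 ≤ (ε / 2 * q ^ (j + 1)) * (c * q / 48) ^ 2 := by
      refine b2.trans (le_of_eq ?_)
      rw [show q ^ (j + 3) = q ^ (j + 1) * q ^ 2 by rw [← pow_add]]
      ring
    exact le_of_mul_le_mul_right this (by positivity)
  linarith

/-- Lower bound constant for the sides. -/
noncomputable def c1 (j : ℕ) : ℝ := 1 / (8 ^ (j + 1) * (4 * CC j))

lemma c1_pos (j : ℕ) : 0 < c1 j := by
  have := CC_pos j
  unfold c1; positivity

lemma side_ge [Nonempty V] (h : Hyp G (j + 1) q) (X : Finset V)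
    (hX : ee G X X + ee G Xᶜ Xᶜ ≤ K0 j k * q ^ (j + 1)) (h1 : 2 * 8 ^ (j + 1) * K0 j k ≤ q) :
    c1 j * q ^ (j + 1) ≤ X.card := by
  have hq := h.hq
  have hC := CC_pos j
  obtain ⟨x⟩ := (inferInstance : Nonempty V)
  have h2 := h.levs_ge (le_refl (j + 1)) x
  have h3 : ((levs G (j + 1) x).card : ℝ) ≤ Fintype.card V := by
    exact_mod_cast Finset.card_le_univ _
  have h4 : (q / 8) ^ (j + 1) ≤ Fintype.card V := h2.trans h3
  rw [div_pow, div_le_iff₀ (by positivity)] at h4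
  have hs := h.hs
  have hc := ee_cross (G := G) X
  have he : ee G X Xᶜ ≤ X.card * (CC j * q) := by
    calc _ ≤ ∑ x ∈ X, CC j * q := Finset.sum_le_sum
            (fun x _ => (op_ind_le_dg _ x).trans (h.D x))
      _ = _ := by simp
  set m : ℝ := ((Fintype.card V : ℕ) : ℝ)
  have hm : 0 ≤ m := by positivity
  have h5 : K0 j k * q ^ (j + 1) ≤ q * m / 2 := by
    have a : K0 j k * q ^ (j + 1) ≤ K0 j k * (m * 8 ^ (j + 1)) :=
      mul_le_mul_of_nonneg_left h4 (K0_pos j k).le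
    have b : (2 * 8 ^ (j + 1) * K0 j k) * m ≤ q * m := mul_le_mul_of_nonneg_right h1 hm
    nlinarith
  have h6 : q * m / 4 ≤ X.card * (CC j * q) := by nlinarith
  have h7 : m / 4 ≤ X.card * CC j := by
    have : q * (m / 4) ≤ q * (X.card * CC j) := by linarith
    exact le_of_mul_le_mul_left this (by linarith)
  unfold c1
  rw [div_mul_eq_mul_div, one_mul, div_le_iff₀ (by positivity)]
  calc _ ≤ m * 8 ^ (j + 1) := h4
    _ ≤ (4 * (X.card * CC j)) * 8 ^ (j + 1) := by gcongr; linarith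
    _ = _ := by ring

theorem pseudo (j k : ℕ) (hj : Even j ∨ j = 1) (hkl : 2 * (j + 1) + 1 ≤ k) {c ε : ℝ} (hc : 0 < c)
    (hε : 0 < ε) : ∃ q0 : ℝ, ∀ (V : Type) [Fintype V] [Nonempty V] (G : SimpleGraph V) (q : ℝ),
      Hyp G (j + 1) q → ¬ HasCycleLength G k → q0 ≤ q → ∃ X : Finset V,
        c1 j * q ^ (j + 1) ≤ X.card ∧ c1 j * q ^ (j + 1) ≤ Xᶜ.card ∧
        Expd G c ε q (j + 1) X ∧ Expd G c ε q (j + 1) Xᶜ := by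
  refine ⟨max (2 * 8 ^ (j + 1) * K0 j k) (max (16 * K0 j k / ε)
    (K5 j k / (ε * c ^ 2 / (2 * 48 ^ 2)) ^ (j + 1))), ?_⟩
  intro V _ _ G q h hk hq
  obtain ⟨X, hX⟩ := near_bip h hk hkl
  have hX' : ee G Xᶜ Xᶜ + ee G Xᶜᶜ Xᶜᶜ ≤ K0 j k * q ^ (j + 1) := by
    rw [compl_compl]; linarith
  have q1 := (le_max_left _ _).trans hq
  have q2 := ((le_max_left _ _).trans (le_max_right _ _)).trans hq
  have q3 := ((le_max_right _ _).trans (le_max_right _ _)).trans hq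
  exact ⟨X, side_ge h X hX q1, side_ge h Xᶜ hX' q1, expd h hj X hX hc hε q2 q3,
    expd h hj Xᶜ hX' hc hε q2 q3⟩

end pseudo
end ECF

namespace ECF
open SimpleGraph
open scoped Classical

section bip
set_option linter.unusedSectionVars false
variable {V : Type} [Fintype V] {G : SimpleGraph V} {j k : ℕ} {q : ℝ}

/-- Greedy descent through a sequence of sets. -/
lemma path_down (W : ℕ → Finset V) (t : ℕ)
    (hW : ∀ i, ∀ y ∈ W (i + 1), t < (nbr G y ∩ W i).card) :
    ∀ (i : ℕ) (a : V) (F : Finset V), a ∈ W (i + 1) → a ∉ F → F.card + i ≤ t →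
      ∃ y ∈ W 1, ∃ p : G.Walk a y, p.IsPath ∧ p.length = i ∧ ∀ z ∈ p.support, z ∉ F := by
  intro i
  induction i with
  | zero =>
    intro a F ha haF _
    exact ⟨a, ha, Walk.nil, by simp, by simp, by simpa using haF⟩
  | succ i ih =>
    intro a F ha haF hF
    have h1 := hW _ a ha
    have h2 : (insert a F).card ≤ F.card + 1 := Finset.card_insert_le _ _
    obtain ⟨a', ha', hn⟩ := Finset.exists_mem_notMem_of_card_lt_card
      (show (insert a F).card < (nbr G a ∩ W (i + 1)).card by omega)
    rw [Finset.mem_inter, mem_nbr] at ha'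
    obtain ⟨y, hy, p, hp, hl, hs⟩ := ih a' (insert a F) ha'.2 hn (by omega)
    refine ⟨y, hy, Walk.cons ha'.1 p, ?_, by simp [hl], ?_⟩
    · rw [Walk.cons_isPath_iff]
      exact ⟨hp, fun hh => hs a hh (by simp)⟩
    · intro z hz
      rw [Walk.support_cons, List.mem_cons] at hz
      rcases hz with rfl | hz
      · exact haF
      · exact fun hh => hs z hz (by simp [hh])

/-- Choosing the last vertex with a geodesic avoiding a given set. -/
lemma last_step {ℓ : ℕ} (hG : EvenCycleFree G ℓ) {v y : V} (F W : Finset V) (hv : v ∉ F)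
    (hy : ∀ i, i < ℓ → ¬ Lev G i v y) (hW : ∀ b ∈ W, Lev G ℓ v b)
    (hc : F.card * ℓ < (nbr G y ∩ W).card) :
    ∃ b, G.Adj y b ∧ ∃ p : G.Walk v b, p.IsPath ∧ p.length = ℓ ∧ ∀ z ∈ p.support, z ∉ F := by
  by_contra hcon
  push Not at hcon
  have hbad : ∀ b ∈ nbr G y ∩ W, ∃ zt : V × ℕ, zt ∈ F ×ˢ Finset.range ℓ ∧
      Lev G zt.2 zt.1 b ∧ ∃ s, s + zt.2 = ℓ ∧ Lev G s v zt.1 := by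
    intro b hb
    rw [Finset.mem_inter, mem_nbr] at hb
    obtain ⟨p, hp, hl, hs⟩ := (hW b hb.2).geodesic
    obtain ⟨z, hz, hzF⟩ := hcon b hb.1 p hp hl
    obtain ⟨s, t, hst, h1, h2⟩ := hs z hz
    refine ⟨(z, t), ?_, h2, s, hst, h1⟩
    simp only [Finset.mem_product, Finset.mem_range]
    refine ⟨hzF, ?_⟩
    rcases Nat.eq_zero_or_pos s with rfl | h0
    · exact absurd (lev_zero.1 h1 ▸ hzF) hv
    · omega
  choose! φ hφ1 hφ2 hφ3 using hbad
  have hcard : (F ×ˢ Finset.range ℓ).card < (nbr G y ∩ W).card := by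
    rwa [Finset.card_product, Finset.card_range]
  obtain ⟨b, hb, b', hb', hne, heq⟩ := Finset.exists_ne_map_eq_of_card_lt_of_maps_to hcard
    (f := φ) (fun b hb => hφ1 b hb)
  apply hne
  have l1 := hφ2 b hb
  have l2 := hφ2 b' hb'
  rw [← heq] at l2
  have hr := hφ1 b hb
  rw [Finset.mem_product, Finset.mem_range] at hr
  obtain ⟨s, hs, hs'⟩ := hφ3 b hb
  rw [Finset.mem_inter, mem_nbr] at hb hb'
  refine two_nbrs' hG l1 l2 hr.2 hb.1 hb'.1 (fun i hi hl => ?_)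
  obtain ⟨i', hi', hlv⟩ := (hs'.1.trans hl.1).lev
  exact hy i' (by omega) hlv

/-- Assemble the odd cycle. -/
lemma assemble (h : EvenCycleFree G (j + 1)) {r : ℕ} (hr : 1 ≤ r)
    (hk : k = 2 * (j + 1) + 2 * r + 1) {u v : V} (huv : G.Adj u v) (W : ℕ → Finset V)
    (hW0 : ∀ b ∈ W 0, Lev G (j + 1) v b)
    (hB : ∀ i, ∀ y ∈ W (i + 1), ∀ s, s < j + 1 → ¬ Lev G s v y)
    (hW : ∀ i, ∀ y ∈ W (i + 1), k * (j + 1) < (nbr G y ∩ W i).card)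
    {a : V} (ha : a ∈ W (2 * r)) (hau : Lev G (j + 1) u a) : HasCycleLength G k := by
  obtain ⟨s, rfl⟩ : ∃ s, r = s + 1 := ⟨r - 1, by omega⟩
  obtain ⟨gu, g1, g2, g3⟩ := hau.geodesic
  have hvg : v ∉ gu.support := by
    intro hv
    obtain ⟨x, t, hxt, l1, l2⟩ := g3 v hv
    have := l1.unique (lev_one.2 huv)
    exact hB (2 * s + 1) a ha t (by omega) l2
  have hav : a ≠ v := fun e => hvg (e ▸ Walk.end_mem_support gu)
  set F : Finset V := insert v (gu.support.toFinset.erase a) with hF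
  have hkk : k ≤ k * (j + 1) := Nat.le_mul_of_pos_right _ (by omega)
  have hc1 := card_support gu
  have hFc : F.card ≤ j + 1 + 1 := by
    have h1 : F.card ≤ (gu.support.toFinset.erase a).card + 1 := Finset.card_insert_le _ _
    have h2 : (gu.support.toFinset.erase a).card = gu.support.toFinset.card - 1 :=
      Finset.card_erase_of_mem (by simp)
    omega
  obtain ⟨y, hy, p, p1, p2, p3⟩ := path_down W (k * (j + 1)) hW (2 * s + 1) a F ha
    (by simp [hF, hav]) (by omega)
  have hc2 := card_support p
  set F2 : Finset V := gu.support.toFinset ∪ p.support.toFinset with hF2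
  have hF2c : F2.card ≤ k := by
    have : F2.card ≤ gu.support.toFinset.card + p.support.toFinset.card :=
      Finset.card_union_le _ _
    omega
  have hvp : v ∉ p.support := fun hh => p3 v hh (by simp [hF])
  obtain ⟨b, hyb, g, e1, e2, e3⟩ := last_step h F2 (W 0) (by simp [hF2, hvg, hvp])
    (hB 0 y hy) hW0 (lt_of_le_of_lt (Nat.mul_le_mul_right _ hF2c) (hW 0 y hy))
  have P1 : (gu.append p).IsPath := by
    refine path_append _ _ g1 p1 (fun z h1 h2 => ?_)
    by_contra hne
    exact p3 z h2 (by simp [hF, h1, hne])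
  have P2 : (Walk.cons hyb g.reverse).IsPath := by
    rw [Walk.cons_isPath_iff]
    refine ⟨e1.reverse, fun hh => ?_⟩
    rw [Walk.support_reverse, List.mem_reverse] at hh
    exact e3 y hh (by simp [hF2])
  have P3 : ((gu.append p).append (Walk.cons hyb g.reverse)).IsPath := by
    refine path_append _ _ P1 P2 (fun z h1 h2 => ?_)
    rw [Walk.support_cons, List.mem_cons] at h2
    rcases h2 with h2 | h2
    · exact h2
    · rw [Walk.support_reverse, List.mem_reverse] at h2
      rw [Walk.mem_support_append_iff] at h1
      exact absurd (by simpa [hF2] using h1) (e3 z h2)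
  have hlen : ((gu.append p).append (Walk.cons hyb g.reverse)).length = k - 1 := by
    simp only [Walk.length_append, Walk.length_cons, Walk.length_reverse]
    omega
  have := hasCycle_of_path _ P3 huv.symm (by omega)
  rw [hlen] at this
  rwa [show k - 1 + 1 = k by omega] at this

/-- The alternating side. -/
noncomputable def side (X : Finset V) (i : ℕ) : Finset V := if Even i then X else Xᶜ

lemma side_succ (X : Finset V) (i : ℕ) : side X (i + 1) = (side X i)ᶜ := by
  unfold side
  by_cases h : Even i <;> simp [h, Nat.even_add_one]

/-- The iterated robust neighbourhoods. -/
noncomputable def Wseq (G : SimpleGraph V) (s : ℝ) (X B W0 : Finset V) : ℕ → Finset V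
  | 0 => W0
  | i + 1 => (side X (i + 1)).filter (fun y => s ≤ op G (ind (Wseq G s X B W0 i)) y ∧ y ∉ B)

/-- Half the lower bound for `|N_ℓ|`. -/
noncomputable def c0 (j : ℕ) : ℝ := (1 / 8) ^ (j + 1) / 2

/-- The master constant. -/
noncomputable def kap (j : ℕ) : ℝ := min (c0 j) (c1 j) / 4

lemma kap_pos (j : ℕ) : 0 < kap j := by
  have := c1_pos j
  have : 0 < c0 j := by unfold c0; positivity
  unfold kap
  positivity

lemma kap_c0 (j : ℕ) : 4 * kap j ≤ c0 j := by
  unfold kap; linarith [min_le_left (c0 j) (c1 j)]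

lemma kap_c1 (j : ℕ) : 4 * kap j ≤ c1 j := by
  unfold kap; linarith [min_le_right (c0 j) (c1 j)]

lemma no_same (h : Hyp G (j + 1) q) {r : ℕ} (hr : 1 ≤ r)
    (hk : k = 2 * (j + 1) + 2 * r + 1) (hkf : ¬ HasCycleLength G k) (X : Finset V)
    (hX1 : c1 j * q ^ (j + 1) ≤ X.card) (hX2 : c1 j * q ^ (j + 1) ≤ Xᶜ.card)
    (hE1 : Expd G (kap j) (kap j) q (j + 1) X) (hE2 : Expd G (kap j) (kap j) q (j + 1) Xᶜ)
    (hq1 : 2 * CC j ^ j / kap j ≤ q) (hq2 : 48 * (k * (j + 1) + 1) / kap j ≤ q)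
    {u v : V} (huv : G.Adj u v) (hu : c0 j * q ^ (j + 1) ≤ (levs G (j + 1) u ∩ X).card)
    (hv : c0 j * q ^ (j + 1) ≤ (levs G (j + 1) v ∩ X).card) : False := by
  have hq := h.hq
  have hκ := kap_pos j
  have hκ0 := kap_c0 j
  have hκ1 := kap_c1 j
  have hC := one_le_CC j
  have hQ : 0 < q ^ j := by positivity
  have hQ1 : 0 < q ^ (j + 1) := by positivity
  set κ := kap j with hκd
  set B : Finset V := (Finset.range (j + 1)).biUnion (fun i => levs G i v) with hB
  have hBc : (B.card : ℝ) ≤ κ * q ^ (j + 1) := by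
    calc (B.card : ℝ) ≤ ((∑ i ∈ Finset.range (j + 1), (levs G i v).card : ℕ) : ℝ) := by
          exact_mod_cast Finset.card_biUnion_le
      _ = ∑ i ∈ Finset.range (j + 1), ((levs G i v).card : ℝ) := by push_cast; rfl
      _ ≤ ∑ i ∈ Finset.range (j + 1), (CC j * q) ^ i :=
          Finset.sum_le_sum (fun i _ => levs_le v h.D)
      _ ≤ 2 * (CC j * q) ^ j := geom_le (by nlinarith) j
      _ = 2 * CC j ^ j * q ^ j := by rw [mul_pow]; ring
      _ ≤ (q * κ) * q ^ j := by
          rw [div_le_iff₀ hκ] at hq1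
          gcongr
      _ = _ := by rw [pow_succ]; ring
  set s : ℝ := κ / 48 * q with hs
  set W := Wseq G s X B (levs G (j + 1) v ∩ X) with hW
  have hW0 : W 0 = levs G (j + 1) v ∩ X := rfl
  have hWs : ∀ i, W (i + 1) = (side X (i + 1)).filter (fun y => s ≤ op G (ind (W i)) y ∧ y ∉ B) :=
    fun i => rfl
  have hside : ∀ i, c1 j * q ^ (j + 1) ≤ (side X i).card := by
    intro i; unfold side; split_ifs
    · exact hX1
    · exact hX2
  have hE : ∀ i, Expd G κ κ q (j + 1) (side X i) := by
    intro i; unfold side; split_ifs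
    · exact hE1
    · exact hE2
  have hstep : ∀ i, W i ⊆ side X i → κ * q ^ (j + 1) ≤ (W i).card →
      ((side X (i + 1) \ W (i + 1)).card : ℝ) ≤ 2 * κ * q ^ (j + 1) := by
    intro i h1 h2
    have h3 := hE i _ h1 h2
    rw [← side_succ] at h3
    have h4 : side X (i + 1) \ W (i + 1) ⊆
        (side X (i + 1)).filter (fun y => op G (ind (W i)) y < κ / 48 * q) ∪ B := by
      intro y hy
      rw [hWs] at hy
      simp only [Finset.mem_sdiff, Finset.mem_filter, not_and, not_not] at hy
      simp only [Finset.mem_union, Finset.mem_filter]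
      by_cases hyB : y ∈ B
      · exact Or.inr hyB
      · refine Or.inl ⟨hy.1, ?_⟩
        by_contra hc
        exact hyB (hy.2 hy.1 (not_lt.1 hc))
    have h5 : ((side X (i + 1) \ W (i + 1)).card : ℝ) ≤
        ((side X (i + 1)).filter (fun y => op G (ind (W i)) y < κ / 48 * q)).card + B.card := by
      exact_mod_cast (Finset.card_le_card h4).trans (Finset.card_union_le _ _)
    linarith
  have hmain : ∀ i, W i ⊆ side X i ∧ κ * q ^ (j + 1) ≤ (W i).card := by
    intro i
    induction i with
    | zero =>
      rw [hW0]
      refine ⟨by simp [side, Finset.inter_subset_right], ?_⟩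
      nlinarith
    | succ i ih =>
      have h1 := hstep i ih.1 ih.2
      have hsub : W (i + 1) ⊆ side X (i + 1) := by rw [hWs]; exact Finset.filter_subset _ _
      refine ⟨hsub, ?_⟩
      have h2 : ((side X (i + 1) \ W (i + 1)).card : ℝ) + (W (i + 1)).card =
          (side X (i + 1)).card := by
        exact_mod_cast Finset.card_sdiff_add_card_eq_card hsub
      have h3 := hside (i + 1)
      nlinarith
  obtain ⟨a, ha, haU⟩ : ∃ a, a ∈ W (2 * r) ∧ Lev G (j + 1) u a := by
    by_contra hcon
    push Not at hcon
    obtain ⟨t, rfl⟩ : ∃ t, r = t + 1 := ⟨r - 1, by omega⟩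
    have h1 := hstep (2 * t + 1) (hmain _).1 (hmain _).2
    have e : side X (2 * t + 1 + 1) = X := by
      unfold side; rw [if_pos ⟨t + 1, by omega⟩]
    rw [e] at h1
    have h2 : levs G (j + 1) u ∩ X ⊆ X \ W (2 * t + 1 + 1) := by
      intro x hx
      rw [Finset.mem_inter, mem_levs] at hx
      rw [Finset.mem_sdiff]
      exact ⟨hx.2, fun hh => hcon x hh hx.1⟩
    have h3 : ((levs G (j + 1) u ∩ X).card : ℝ) ≤ (X \ W (2 * t + 1 + 1)).card := by
      exact_mod_cast Finset.card_le_card h2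
    nlinarith
  refine hkf (assemble h.free hr hk huv W (fun b hb => ?_) (fun i y hy t ht hl => ?_)
    (fun i y hy => ?_) ha haU)
  · rw [hW0, Finset.mem_inter, mem_levs] at hb
    exact hb.1
  · rw [hWs, Finset.mem_filter] at hy
    exact hy.2.2 (by rw [hB, Finset.mem_biUnion]; exact ⟨t, by simpa using ht, by simpa using hl⟩)
  · rw [hWs, Finset.mem_filter, op_ind] at hy
    have h1 := hy.2.1
    rw [div_le_iff₀ hκ] at hq2
    have h2 : ((k * (j + 1) : ℕ) : ℝ) < (nbr G y ∩ W i).card := by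
      push_cast
      rw [hs] at h1
      linarith
    exact_mod_cast h2

theorem girth_gen (j k : ℕ) (hj : Even j ∨ j = 1) (hk : Odd k) (hkl : 2 * (j + 1) + 2 < k) :
    ∃ q0 : ℝ, ∀ (V : Type) [Fintype V] [Nonempty V] (G : SimpleGraph V) (q : ℝ),
      Hyp G (j + 1) q → ¬ HasCycleLength G k → q0 ≤ q →
      ∀ m, m ≤ 2 * (j + 1) + 1 → ¬ HasCycleLength G m := by
  obtain ⟨r, hr, hkr⟩ : ∃ r, 1 ≤ r ∧ k = 2 * (j + 1) + 2 * r + 1 := by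
    obtain ⟨t, ht⟩ := hk
    exact ⟨t - (j + 1), by omega, by omega⟩
  obtain ⟨q0, H⟩ := pseudo j k hj (by omega) (kap_pos j) (kap_pos j)
  refine ⟨max q0 (max (2 * CC j ^ j / kap j) (48 * (k * (j + 1) + 1) / kap j)), ?_⟩
  intro V _ _ G q h hkf hq
  have q1 := (le_max_left _ _).trans hq
  have q2 := ((le_max_left _ _).trans (le_max_right _ _)).trans hq
  have q3 := ((le_max_right _ _).trans (le_max_right _ _)).trans hq
  obtain ⟨X, hX1, hX2, hE1, hE2⟩ := H V G q h hkf q1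
  have hhalf : ∀ u, ¬ c0 j * q ^ (j + 1) ≤ (levs G (j + 1) u ∩ X).card →
      c0 j * q ^ (j + 1) ≤ (levs G (j + 1) u ∩ Xᶜ).card := by
    intro u hu
    have h1 := h.levs_ge (le_refl (j + 1)) u
    have h2 : ((levs G (j + 1) u ∩ X).card : ℝ) + (levs G (j + 1) u ∩ Xᶜ).card =
        (levs G (j + 1) u).card := by
      rw [← Finset.sdiff_eq_inter_compl]
      exact_mod_cast Finset.card_inter_add_card_sdiff _ _
    have h3 : (q / 8) ^ (j + 1) = 2 * (c0 j * q ^ (j + 1)) := by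
      unfold c0; rw [div_pow, div_pow]; ring
    push Not at hu
    linarith
  let col : G.Coloring Bool := Coloring.mk
    (fun u => decide (c0 j * q ^ (j + 1) ≤ ((levs G (j + 1) u ∩ X).card : ℝ))) (by
      intro u v huv heq
      rw [decide_eq_decide] at heq
      by_cases hu : c0 j * q ^ (j + 1) ≤ ((levs G (j + 1) u ∩ X).card : ℝ)
      · exact no_same h hr hkr hkf X hX1 hX2 hE1 hE2 q2 q3 huv hu (heq.1 hu)
      · exact no_same h hr hkr hkf Xᶜ hX2 (by rwa [compl_compl]) hE2 (by rwa [compl_compl])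
          q2 q3 huv (hhalf u hu) (hhalf v (fun hh => hu (heq.2 hh))))
  rintro m hm ⟨v, w, hw, hl⟩
  have he : Even w.length := (col.even_length_iff_congr w).2 Iff.rfl
  have h3 := hw.three_le_length
  obtain ⟨t, ht⟩ := he
  exact h.free t (by omega) (by omega) ⟨v, w, hw, by omega⟩

end bip
end ECF

namespace ECF
open SimpleGraph
open scoped Classical

section fin
set_option linter.unusedSectionVars false

lemma girth_all (ℓ k : ℕ) (hℓ : ℓ = 2 ∨ ℓ = 3 ∨ ℓ = 5)
    (hk : Odd k) (hk2 : 2 * ℓ + 2 < k ∨ (ℓ = 2 ∧ k = 5)) :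
    ∃ q0 : ℝ, ∀ (V : Type) [Fintype V] [Nonempty V] (G : SimpleGraph V) (q : ℝ),
      Hyp G ℓ q → ¬ HasCycleLength G k → q0 ≤ q →
      ∀ m, m ≤ 2 * ℓ + 1 → ¬ HasCycleLength G m := by
  rcases hk2 with hk2 | ⟨rfl, rfl⟩
  · rcases hℓ with rfl | rfl | rfl
    · exact girth_gen 1 k (Or.inr rfl) hk hk2
    · exact girth_gen 2 k (Or.inl (by decide)) hk hk2
    · exact girth_gen 4 k (Or.inl (by decide)) hk hk2
  · exact ⟨100000, fun V _ _ G q h h5 hq => girth_two h h5 hq⟩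

lemma lift_cycle {V : Type} (G : SimpleGraph V) (x : V) {m : ℕ}
    (h : HasCycleLength (G.comap (Subtype.val : {y : V // y ≠ x} → V)) m) :
    HasCycleLength G m := by
  obtain ⟨v, w, hw, hl⟩ := h
  let f : G.comap (Subtype.val : {y : V // y ≠ x} → V) →g G := ⟨Subtype.val, fun h => h⟩
  exact ⟨v.1, w.map f, hw.map (f := f) Subtype.val_injective, by simpa using hl⟩

lemma sum_dg_del {V : Type} [Fintype V] (G : SimpleGraph V) (x : V) :
    ∑ y, dg G y - 2 * dg G x ≤
      ∑ y, dg (G.comap (Subtype.val : {y : V // y ≠ x} → V)) y := by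
  set G' := G.comap (Subtype.val : {y : V // y ≠ x} → V) with hG'
  have h1 : ∀ y : {y : V // y ≠ x}, dg G y.1 - ind (nbr G x) y.1 ≤ dg G' y := by
    intro y
    have hsub : nbr G y.1 ⊆ (nbr G' y).map ⟨Subtype.val, Subtype.val_injective⟩ ∪
        (if G.Adj x y.1 then {x} else ∅) := by
      intro z hz
      rw [mem_nbr] at hz
      rw [Finset.mem_union]
      by_cases hzx : z = x
      · right
        subst hzx
        simp [hz.symm]
      · left
        rw [Finset.mem_map]
        exact ⟨⟨z, hzx⟩, by simpa [hG'] using hz, rfl⟩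
    have h2 := (Finset.card_le_card hsub).trans (Finset.card_union_le _ _)
    rw [Finset.card_map] at h2
    have h3 : ((nbr G y.1).card : ℝ) ≤ (nbr G' y).card + ind (nbr G x) y.1 := by
      unfold ind
      by_cases hadj : G.Adj x y.1
      · simp only [hadj, if_true, Finset.card_singleton, mem_nbr] at h2 ⊢
        exact_mod_cast h2
      · simp only [hadj, if_false, Finset.card_empty, mem_nbr] at h2 ⊢
        simpa using h2
    unfold dg
    linarith
  refine le_trans ?_ (Finset.sum_le_sum (fun y _ => h1 y))
  rw [← Finset.sum_subtype (Finset.univ.erase x) (by simp)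
    (fun y => dg G y - ind (nbr G x) y), Finset.sum_sub_distrib]
  have h4 := Finset.add_sum_erase Finset.univ (fun y => dg G y) (Finset.mem_univ x)
  have h5 : ∑ y ∈ Finset.univ.erase x, ind (nbr G x) y ≤ dg G x := by
    calc _ ≤ ∑ y, ind (nbr G x) y := Finset.sum_le_sum_of_subset_of_nonneg (Finset.subset_univ _)
          (fun z _ _ => ind_nonneg _ z)
      _ = _ := by rw [sum_ind]; rfl
  linarith

lemma reduce {ℓ k : ℕ} (hℓ : 1 ≤ ℓ) {q q0 : ℝ} (H : ∀ (V : Type) [Fintype V] [Nonempty V]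
      (G : SimpleGraph V) (q : ℝ), Hyp G ℓ q → ¬ HasCycleLength G k → q0 ≤ q →
      ∀ m, m ≤ 2 * ℓ + 1 → ¬ HasCycleLength G m) (hq : 16 ≤ q) (hq0 : q0 ≤ q) :
    ∀ (n : ℕ) (V : Type) [Fintype V] [Nonempty V] (G : SimpleGraph V), Fintype.card V = n →
      EvenCycleFree G ℓ → ¬ HasCycleLength G k → (q + 1) * Fintype.card V ≤ ∑ x, dg G x →
      (Fintype.card V : ℝ) ≤ 2 * ∑ i ∈ Finset.range (ℓ + 1), q ^ i →
      (Fintype.card V : ℝ) = 2 * ∑ i ∈ Finset.range (ℓ + 1), q ^ i ∧ Hyp G ℓ q := by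
  intro n
  induction n with
  | zero =>
    intro V _ _ G hn
    exact absurd hn Fintype.card_ne_zero
  | succ n ih =>
    intro V _ _ G hn hf hk hs hm
    by_cases hd : ∀ x, q / 4 ≤ dg G x
    · have hyp : Hyp G ℓ q := ⟨hf, hq, hd, hs, hm⟩
      exact ⟨(final_lemma hℓ (H V G q hyp hk hq0) hyp.two_le (by linarith) hs hm).1, hyp⟩
    · exfalso
      push Not at hd
      obtain ⟨x, hx⟩ := hd
      have h1 := sum_dg_del G x
      set G' := G.comap (Subtype.val : {y : V // y ≠ x} → V) with hG'
      have hc : Fintype.card {y : V // y ≠ x} = n := by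
        rw [Fintype.card_subtype_compl, Fintype.card_subtype_eq]; omega
      have hcr : (Fintype.card V : ℝ) = n + 1 := by rw [hn]; push_cast; rfl
      rw [hcr] at hs hm
      by_cases hne : Nonempty {y : V // y ≠ x}
      · have := (ih {y : V // y ≠ x} G' hc
          (fun m h2 h3 h4 => hf m h2 h3 (lift_cycle G x h4)) (fun h4 => hk (lift_cycle G x h4))
          (by rw [hc]; linarith) (by rw [hc]; linarith)).1
        rw [hc] at this
        linarith
      · rw [not_nonempty_iff] at hne
        have h2 : ∑ y, dg G' y = 0 := Finset.sum_eq_zero (fun y _ => (hne.false y).elim)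
        rw [h2] at h1
        have : (0 : ℝ) ≤ (q + 1) * n := by positivity
        linarith

end fin
end ECF

theorem exact_structure_even_cycles (ℓ k : ℕ) (hℓ : ℓ = 2 ∨ ℓ = 3 ∨ ℓ = 5)
    (hk : Odd k) (hk2 : 2 * ℓ + 2 < k ∨ (ℓ = 2 ∧ k = 5)) :
    ∃ N : ℕ, ∀ n : ℕ, N < n → ∀ q : ℝ, 0 < q →
      (n : ℝ) = 2 * ∑ i ∈ Finset.range (ℓ + 1), q ^ i →
      ∀ G : SimpleGraph (Fin n), EvenCycleFree G ℓ → ¬ HasCycleLength G k →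
      (q + 1) * n / 2 ≤ (G.edgeSet.ncard : ℝ) →
      -- q is a positive integer
      (∃ qn : ℕ, 0 < qn ∧ (qn : ℝ) = q) ∧
      -- G is bipartite with both parts of size n/2
      (∃ A : Set (Fin n), (∀ u v, G.Adj u v → (u ∈ A ↔ v ∉ A)) ∧
        2 * A.ncard = n ∧ 2 * Aᶜ.ncard = n) ∧
      -- every vertex has degree q + 1
      (∀ v, ((G.neighborSet v).ncard : ℝ) = q + 1) ∧
      -- so e(G) = (q+1)n/2
      (G.edgeSet.ncard : ℝ) = (q + 1) * n / 2 ∧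
      -- no cycle of length at most 2ℓ + 1
      (∀ m, m ≤ 2 * ℓ + 1 → ¬ HasCycleLength G m) ∧
      -- any two vertices are at distance at most ℓ + 1
      (∀ u v : Fin n, ∃ w : G.Walk u v, w.length ≤ ℓ + 1) := by
  classical
  obtain ⟨q0, H⟩ := ECF.girth_all ℓ k hℓ hk hk2
  have hl1 : 1 ≤ ℓ := by omega
  refine ⟨⌈2 * ∑ i ∈ Finset.range (ℓ + 1), (max q0 16) ^ i⌉₊, ?_⟩
  intro n hn q hq hnq G hG hGk he
  have hqq : max q0 16 ≤ q := by
    by_contra hc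
    push Not at hc
    have h1 : ∑ i ∈ Finset.range (ℓ + 1), q ^ i ≤ ∑ i ∈ Finset.range (ℓ + 1), (max q0 16) ^ i :=
      Finset.sum_le_sum (fun i _ => pow_le_pow_left₀ hq.le hc.le i)
    have h2 := Nat.lt_of_ceil_lt hn
    linarith
  have hq0 : q0 ≤ q := (le_max_left _ _).trans hqq
  have hq16 : 16 ≤ q := (le_max_right _ _).trans hqq
  have hn0 : 0 < n := by omega
  have : Nonempty (Fin n) := ⟨⟨0, hn0⟩⟩
  have hsum := ECF.sum_dg (G := G)
  have hs : (q + 1) * (Fintype.card (Fin n) : ℝ) ≤ ∑ x, ECF.dg G x := by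
    rw [hsum, Fintype.card_fin]; linarith
  have hm : (Fintype.card (Fin n) : ℝ) ≤ 2 * ∑ i ∈ Finset.range (ℓ + 1), q ^ i := by
    rw [Fintype.card_fin, hnq]
  obtain ⟨-, hyp⟩ := ECF.reduce hl1 H hq16 hq0 n (Fin n) G (Fintype.card_fin n) hG hGk hs hm
  have hg := H (Fin n) G q hyp hGk hq0
  obtain ⟨-, hdeg, ⟨A, hA, hA1, hA2⟩, hdist⟩ :=
    ECF.final_lemma hl1 hg hyp.two_le (by linarith) hs hm
  refine ⟨?_, ⟨(A : Set (Fin n)), ?_, ?_, ?_⟩, ?_, ?_, hg, hdist⟩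
  · have h0 := hdeg ⟨0, hn0⟩
    have h1 : ((ECF.nbr G ⟨0, hn0⟩).card : ℝ) = q + 1 := h0
    have h2 : (1 : ℝ) < ((ECF.nbr G ⟨0, hn0⟩).card : ℝ) := by linarith
    have h3 : 1 < (ECF.nbr G ⟨0, hn0⟩).card := by exact_mod_cast h2
    refine ⟨(ECF.nbr G ⟨0, hn0⟩).card - 1, by omega, ?_⟩
    rw [Nat.cast_sub h3.le, h1]
    push_cast
    ring
  · simpa using hA
  · rw [Set.ncard_coe_finset, hA1, Fintype.card_fin]
  · rw [← Finset.coe_compl, Set.ncard_coe_finset]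
    rw [Fintype.card_fin] at hA2
    convert hA2
  · intro v
    rw [← hdeg v]
    have : G.neighborSet v = (ECF.nbr G v : Set (Fin n)) := by
      ext y; simp
    rw [this, Set.ncard_coe_finset]
    rfl
  · have h1 : ∑ x, ECF.dg G x = n * (q + 1) := by
      rw [Finset.sum_congr rfl (fun x _ => hdeg x)]
      simp
      ring
    rw [hsum] at h1
    linarith
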